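/- arXiv:2506.11359 — 2 statements merged into one kernel-verified Lean document; each statement's English description precedes it below -/
import Mathlib

section
/- For every integer m with 117 ≤ m ≤ 616000, the sum T_m of 1/n over all integers n with m ≤ n ≤ 10m and P(n) < √(9m + 1) is strictly less than 1. -/
/-- `P n` is the largest prime divisor of `n`, with the convention `P 1 = 1`. -/
def maxPrimeFac (n : ℕ) : ℕ := max 1 (n.primeFactors.sup id)

open scoped Classical in
/-- `T m` is the sum of `1/n` over all integers `n` with `m ≤ n ≤ 10m` and
`P(n) < √(9m + 1)`. -/
noncomputable def T (m : ℕ) : ℝ :=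
  ∑ n ∈ (Finset.Icc m (10 * m)).filter
      (fun n => (maxPrimeFac n : ℝ) < Real.sqrt (9 * (m : ℝ) + 1)), (1 : ℝ) / n

def blk : List (ℕ × ℕ × ℕ) := [
  (37, 37, 1), (41, 41, 1), (43, 43, 1), (47, 47, 1), (53, 53, 1), (59, 59, 1), (61, 61, 1),
  (67, 67, 1), (71, 71, 1), (73, 73, 1), (79, 79, 1), (83, 83, 1), (89, 89, 1), (97, 97, 1),
  (101, 101, 1), (103, 103, 1), (107, 107, 1), (109, 109, 1), (113, 113, 1), (127, 127, 1),
  (131, 131, 1), (137, 137, 1), (139, 139, 1), (149, 149, 1), (151, 151, 1), (157, 157, 1),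
  (163, 163, 1), (167, 167, 1), (173, 173, 1), (179, 179, 1), (181, 181, 1), (191, 191, 1),
  (193, 193, 1), (197, 197, 1), (199, 199, 1), (211, 211, 1), (223, 223, 1), (227, 227, 1),
  (229, 229, 1), (233, 233, 1), (239, 239, 1), (241, 241, 1), (251, 251, 1), (257, 257, 1),
  (263, 263, 1), (269, 269, 1), (271, 271, 1), (277, 277, 1), (281, 281, 1), (283, 283, 1),
  (293, 293, 1), (307, 307, 1), (311, 311, 1), (313, 313, 1), (317, 317, 1), (331, 331, 1),
  (337, 337, 1), (347, 347, 1), (349, 349, 1), (353, 353, 1), (359, 359, 1), (367, 367, 1),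
  (373, 373, 1), (379, 379, 1), (383, 383, 1), (389, 389, 1), (397, 397, 1), (401, 401, 1),
  (409, 409, 1), (419, 419, 1), (421, 421, 1), (431, 431, 1), (433, 433, 1), (439, 439, 1),
  (443, 443, 1), (449, 449, 1), (457, 457, 1), (461, 461, 1), (463, 463, 1), (467, 467, 1),
  (479, 479, 1), (487, 487, 1), (491, 491, 1), (499, 499, 1), (503, 503, 1), (509, 509, 1),
  (521, 521, 1), (523, 523, 1), (541, 541, 1), (547, 547, 1), (557, 557, 1), (563, 563, 1),
  (569, 569, 1), (571, 571, 1), (577, 577, 1), (587, 587, 1), (593, 593, 1), (599, 599, 1),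
  (601, 601, 1), (607, 607, 1), (613, 613, 1), (617, 617, 1), (619, 619, 1), (631, 631, 1),
  (641, 641, 1), (643, 643, 1), (647, 647, 1), (653, 653, 1), (659, 659, 1), (661, 661, 1),
  (673, 673, 1), (677, 677, 1), (683, 683, 1), (691, 691, 1), (701, 701, 1), (709, 709, 1),
  (719, 719, 1), (727, 727, 1), (733, 733, 1), (739, 739, 1), (743, 743, 1), (751, 751, 1),
  (757, 757, 1), (761, 761, 1), (769, 769, 1), (773, 773, 1), (787, 787, 1), (797, 797, 1),
  (809, 809, 1), (811, 811, 1), (821, 821, 1), (823, 823, 1), (827, 827, 1), (829, 829, 1),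
  (839, 839, 1), (853, 853, 1), (857, 857, 1), (859, 859, 1), (863, 863, 1), (877, 877, 1),
  (881, 881, 1), (883, 883, 1), (887, 887, 1), (907, 907, 1), (911, 911, 1), (919, 919, 1),
  (929, 929, 1), (937, 937, 1), (941, 941, 1), (947, 947, 1), (953, 953, 1), (967, 967, 1),
  (971, 971, 1), (977, 977, 1), (983, 983, 1), (991, 991, 1), (997, 997, 1), (1009, 1009, 1),
  (1013, 1013, 1), (1019, 1019, 1), (1021, 1021, 1), (1031, 1031, 1), (1033, 1033, 1),
  (1039, 1039, 1), (1049, 1049, 1), (1051, 1051, 1), (1061, 1061, 1), (1063, 1063, 1),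
  (1069, 1069, 1), (1087, 1087, 1), (1091, 1091, 1), (1093, 1093, 1), (1097, 1097, 1),
  (1103, 1103, 1), (1109, 1109, 1), (1117, 1117, 1), (1123, 1123, 1), (1129, 1129, 1),
  (1151, 1151, 1), (1153, 1153, 1), (1163, 1163, 1), (1171, 1171, 1), (1181, 1181, 1),
  (1187, 1187, 1), (1193, 1193, 1), (1201, 1235, 6), (1237, 1271, 3), (1273, 1309, 9),
  (1311, 1347, 3), (1349, 1387, 4), (1389, 1427, 4), (1429, 1469, 7), (1471, 1513, 8),
  (1515, 1557, 5), (1559, 1603, 7), (1605, 1651, 7), (1653, 1699, 7), (1701, 1749, 6),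
  (1751, 1801, 7), (1803, 1855, 4), (1857, 1909, 9), (1911, 1965, 5), (1967, 2023, 9),
  (2025, 2083, 8), (2085, 2145, 10), (2147, 2209, 5), (2211, 2275, 9), (2277, 2343, 9),
  (2345, 2413, 11), (2415, 2485, 9), (2487, 2559, 8), (2561, 2635, 7), (2637, 2713, 14),
  (2715, 2793, 10), (2795, 2875, 10), (2877, 2961, 10), (2963, 3049, 11), (3051, 3139, 9),
  (3141, 3233, 11), (3235, 3329, 12), (3331, 3427, 11), (3429, 3529, 13), (3531, 3633, 15),
  (3635, 3741, 14), (3743, 3853, 13), (3855, 3967, 14), (3969, 4085, 13), (4087, 4207, 13),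
  (4209, 4333, 16), (4335, 4463, 16), (4465, 4595, 14), (4597, 4731, 17), (4733, 4871, 14),
  (4873, 5017, 20), (5019, 5167, 16), (5169, 5321, 16), (5323, 5479, 20), (5481, 5643, 17),
  (5645, 5811, 21), (5813, 5985, 20), (5987, 6163, 21), (6165, 6347, 23), (6349, 6537, 18),
  (6539, 6733, 24), (6735, 6935, 22), (6937, 7143, 24), (7145, 7357, 23), (7359, 7577, 25),
  (7579, 7803, 25), (7805, 8037, 23), (8039, 8277, 28), (8279, 8525, 24), (8527, 8779, 32),
  (8781, 9041, 29), (9043, 9311, 29), (9313, 9589, 32), (9591, 9875, 34), (9877, 10171, 31),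
  (10173, 10475, 32), (10477, 10789, 33), (10791, 11111, 31), (11113, 11443, 35),
  (11445, 11785, 32), (11787, 12137, 40), (12139, 12501, 40), (12503, 12875, 40),
  (12877, 13261, 44), (13263, 13657, 37), (13659, 14065, 45), (14067, 14487, 39),
  (14489, 14921, 49), (14923, 15367, 49), (15369, 15827, 52), (15829, 16301, 45),
  (16303, 16789, 47), (16791, 17291, 48), (17293, 17809, 56), (17811, 18343, 59),
  (18345, 18893, 47), (18895, 19459, 57), (19461, 20041, 60), (20043, 20641, 61),
  (20643, 21259, 61), (21261, 21895, 68), (21897, 22551, 65), (22553, 23227, 71),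
  (23229, 23923, 70), (23925, 24639, 67), (24641, 25377, 70), (25379, 26137, 73),
  (26139, 26921, 81), (26923, 27727, 69), (27729, 28557, 84), (28559, 29413, 90),
  (29415, 30295, 79), (30297, 31203, 87), (31205, 32139, 85), (32141, 33103, 101),
  (33105, 34095, 96), (34097, 35117, 101), (35119, 36169, 95), (36171, 37253, 106),
  (37255, 38369, 103), (38371, 39519, 109), (39521, 40703, 105), (40705, 41923, 119),
  (41925, 43179, 127), (43181, 44473, 112), (44475, 45807, 122), (45809, 47181, 124),
  (47183, 48595, 132), (48597, 50051, 139), (50053, 51551, 138), (51553, 53097, 141),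
  (53099, 54689, 148), (54691, 56329, 146), (56331, 58017, 163), (58019, 59757, 167),
  (59759, 61549, 150), (61551, 63395, 162), (63397, 65295, 170), (65297, 67253, 178),
  (67255, 69269, 179), (69271, 71347, 185), (71349, 73487, 192), (73489, 75691, 200),
  (75693, 77961, 201), (77963, 80299, 205), (80301, 82707, 219), (82709, 85187, 211),
  (85189, 87741, 228), (87743, 90373, 229), (90375, 93083, 240), (93085, 95875, 250),
  (95877, 98751, 240), (98753, 101713, 259), (101715, 104763, 264), (104765, 107905, 264),
  (107907, 111141, 280), (111143, 114475, 280), (114477, 117909, 299), (117911, 121445, 303),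
  (121447, 125087, 310), (125089, 128839, 321), (128841, 132703, 328), (132705, 136683, 342),
  (136685, 140783, 349), (140785, 145005, 343), (145007, 149355, 370), (149357, 153835, 382),
  (153837, 158449, 383), (158451, 163201, 393), (163203, 168097, 396), (168099, 173139, 417),
  (173141, 178333, 424), (178335, 183683, 452), (183685, 189193, 456), (189195, 194867, 468),
  (194869, 200713, 476), (200715, 206733, 487), (206735, 212935, 516), (212937, 219323, 511),
  (219325, 225901, 542), (225903, 232677, 555), (232679, 239657, 544), (239659, 246845, 590),
  (246847, 254249, 597), (254251, 261875, 598), (261877, 269731, 646), (269733, 277821, 641),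
  (277823, 286155, 664), (286157, 294739, 660), (294741, 303581, 698), (303583, 312687, 721),
  (312689, 322067, 766), (322069, 331729, 768), (331731, 341679, 775), (341681, 351929, 810),
  (351931, 362485, 820), (362487, 373359, 831), (373361, 384559, 870), (384561, 396095, 906),
  (396097, 407977, 897), (407979, 420215, 950), (420217, 432821, 986), (432823, 445805, 1014),
  (445807, 459179, 1001), (459181, 472953, 1056), (472955, 487141, 1080), (487143, 501755, 1135),
  (501757, 516807, 1132), (516809, 532311, 1190), (532313, 548279, 1190), (548281, 564727, 1242),
  (564729, 581667, 1286), (581669, 599117, 1318), (599119, 617089, 1367), (617091, 635601, 1365),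
  (635603, 654669, 1408), (654671, 674309, 1463), (674311, 694537, 1512), (694539, 715373, 1554),
  (715375, 736833, 1587), (736835, 758937, 1607), (758939, 781705, 1702), (781707, 805155, 1737),
  (805157, 829309, 1782), (829311, 854187, 1805), (854189, 879811, 1889), (879813, 906205, 1910),
  (906207, 933391, 1993), (933393, 961391, 2005), (961393, 990231, 2072),
  (990233, 1019937, 2179), (1019939, 1050535, 2202), (1050537, 1082051, 2256),
  (1082053, 1114511, 2355), (1114513, 1147945, 2379), (1147947, 1182383, 2504),
  (1182385, 1217853, 2533), (1217855, 1254387, 2570), (1254389, 1292017, 2695),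
  (1292019, 1330777, 2733), (1330779, 1370699, 2823), (1370701, 1411819, 2916),
  (1411821, 1454173, 2988), (1454175, 1497797, 3093), (1497799, 1542729, 3141),
  (1542731, 1589009, 3220), (1589011, 1636679, 3358), (1636681, 1685779, 3409),
  (1685781, 1736351, 3497), (1736353, 1788441, 3619), (1788443, 1842093, 3720),
  (1842095, 1897355, 3874), (1897357, 1954275, 3940), (1954277, 2000001, 3139)]

def wins : List (ℕ × ℕ × ℕ) := [
  (118, 37, 41), (122, 37, 41), (129, 37, 41), (141, 37, 41), (151, 37, 41), (164, 41, 43),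
  (176, 41, 43), (188, 43, 47), (202, 43, 47), (211, 47, 53), (226, 47, 53), (245, 47, 53),
  (262, 53, 59), (293, 53, 59), (316, 59, 61), (359, 59, 61), (408, 61, 67), (466, 67, 71),
  (518, 71, 73), (576, 73, 79), (654, 79, 83), (738, 83, 89), (856, 89, 97), (979, 97, 101),
  (1102, 103, 107), (1231, 109, 113), (1396, 113, 127), (1622, 127, 131), (1894, 137, 139),
  (2228, 149, 151), (2570, 163, 167), (3005, 173, 179), (3502, 191, 193), (4050, 199, 211),
  (4781, 223, 227), (5599, 239, 241), (6620, 257, 263), (7783, 277, 281), (9268, 307, 311),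
  (11113, 331, 337), (13263, 367, 373), (15919, 397, 401), (19114, 439, 443), (22905, 479, 487),
  (27729, 523, 541), (33687, 577, 587), (40870, 641, 643), (49676, 701, 709), (60291, 773, 787),
  (73489, 857, 859), (89832, 947, 953), (109434, 1049, 1051), (134093, 1153, 1163),
  (162052, 1273, 1273), (199793, 1429, 1429), (243048, 1559, 1559), (291336, 1751, 1751),
  (344844, 1857, 1857), (406539, 2025, 2025), (470502, 2211, 2211), (533205, 2345, 2345),
  (592615, 2487, 2487), (616000, 2487, 2487)]

/-! ### Computation -/

/-- Sieve length: bit `sieveL - i` represents the odd number `2 * i + 1`. -/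
def sieveL : ℕ := 1000000

/-- A cheap necessary condition for an odd number to be prime. -/
def goodDiv (d : ℕ) : Bool :=
  [3, 5, 7, 11, 13, 17, 19, 23, 29, 31, 37].all (fun e => d % e != 0 || d == e)

/-- Bit mask of the proper odd multiples of the odd numbers `3, 5, …, 2 * j + 1`. -/
def sieve : ℕ → ℕ
  | 0 => 0
  | j + 1 =>
    if goodDiv (2 * j + 3) = true then
      2 ^ (sieveL - (j + 1)) / (2 ^ (2 * j + 3) - 1) ||| sieve j
    else sieve j

/-- Complement of the sieve: surviving bits are odd primes (apart from `1`). -/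
def sieveZ : ℕ := sieve 707 ^^^ (2 ^ (sieveL + 1) - 1)

/-- One step of parallel bit counting. -/
def step (w N x : ℕ) : ℕ :=
  (x &&& ((2 ^ (2 * w * N) - 1) / (2 ^ w + 1))) +
    ((x >>> w) &&& ((2 ^ (2 * w * N) - 1) / (2 ^ w + 1)))

/-- (A lower bound for) the number of ones among the low `32 * K` bits. -/
def pop (K x : ℕ) : ℕ :=
  step 16 K (step 8 (2 * K) (step 4 (4 * K) (step 2 (8 * K) (step 1 (16 * K) x)))) % (2 ^ 32 - 1)

/-- Check of one block `(s, e, c)`. -/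
def blkOk (s e c : ℕ) : Bool :=
  decide (3 ≤ s) && decide (s % 2 = 1) && decide (e % 2 = 1) && decide (s ≤ e) &&
  decide (e ≤ 2000001) &&
  decide (c ≤ pop ((e - s) / 64 + 1)
    ((sieveZ >>> (sieveL - e / 2)) % 2 ^ ((e - s) / 2 + 1)))

/-- Check of a list of blocks, all of which start at `x` or later. -/
def blksOk : ℕ → List (ℕ × ℕ × ℕ) → Bool
  | _, [] => true
  | x, (s, e, c) :: t => decide (x ≤ s) && blkOk s e c && blksOk (e + 1) t

/-- Packed table of scaled harmonic numbers. -/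
def htab : ℕ → ℕ
  | 0 => 0
  | k + 1 => htab k * 2 ^ 32 + (htab k % 2 ^ 32 + 10 ^ 8 / (k + 1))

/-- The table used. -/
def HT : ℕ := htab 2400

/-- Scaled harmonic numbers read from the table. -/
def hget (k : ℕ) : ℕ := (HT >>> (32 * (2400 - k))) % 2 ^ 32

/-- Check of the table. -/
def hOk : ℕ → Bool
  | 0 => true
  | k + 1 => decide (hget (k + 1) = hget k + 10 ^ 8 / (k + 1)) && hOk k

/-- Lower bound for the sum over non-smooth numbers. -/
def ev (a b q s2 : ℕ) : List (ℕ × ℕ × ℕ) → ℕ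
  | [] => 0
  | (s, e, c) :: t =>
    bif Nat.ble e (10 * a) then
      (bif (Nat.beq s q && Nat.beq e q) || Nat.ble s2 s then
        c * (hget (10 * a / e) - hget ((b - 1) / s)) / e else 0) + ev a b q s2 t
    else 0

/-- Check of all windows. -/
def winsOk : ℕ → List (ℕ × ℕ × ℕ) → Bool
  | a, [] => decide (616000 < a)
  | a, (b, q, s2) :: t =>
    decide (9 * b + 1 ≤ q * q) && decide (q ≤ s2) && decide (10 * b < q * s2) &&
    decide (130730000 < ev a b q s2 blk) && winsOk (b + 1) t

/-- Upper bound for the scaled harmonic sum. -/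
def hup (m : ℕ) : ℕ → ℕ
  | 0 => 0
  | k + 1 => (10 ^ 12 / (m + k) + 1) + hup m k

set_option maxRecDepth 100000

theorem blksOk_blk : blksOk 3 blk = true := by decide +kernel

theorem hOk_all : hOk 2400 = true := by decide +kernel

theorem winsOk_wins : winsOk 117 wins = true := by decide +kernel

theorem hup_117 : hup 117 1054 ≤ 2307300000000 := by decide +kernel

/-! ### Correctness of the sieve -/

theorem pow_form (d t : ℕ) (hd : 2 ≤ d) (ht : 1 ≤ t) :
    ∃ Q, 2 ^ (d * t) = (2 ^ d - 1) * (2 * Q + 1) + 1 := by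
  obtain ⟨r, hr⟩ : ∃ r, 2 ^ d = r + 1 := ⟨2 ^ d - 1, by have := Nat.one_le_two_pow (n := d); omega⟩
  induction t, ht using Nat.le_induction with
  | base => exact ⟨0, by rw [mul_one, hr]; simp⟩
  | succ t ht ih =>
    obtain ⟨Q, hQ⟩ := ih
    refine ⟨2 ^ (d - 1) * (2 * Q + 1), ?_⟩
    have h2 : 2 * (2 ^ (d - 1) * (2 * Q + 1)) = 2 ^ d * (2 * Q + 1) := by
      rw [← mul_assoc, ← pow_succ']
      congr 2
      omega
    rw [h2, mul_add, mul_one, pow_add, hQ, hr]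
    simp only [Nat.add_sub_cancel]
    ring

theorem mask_bit (A d t : ℕ) (hd : 2 ≤ d) (ht : 1 ≤ t) (h : d * t ≤ A) :
    (2 ^ A / (2 ^ d - 1)).testBit (A - d * t) = true := by
  have h4 : 2 ^ 2 ≤ 2 ^ d := Nat.pow_le_pow_right (by norm_num) hd
  rw [Nat.testBit_eq_decide_div_mod_eq, decide_eq_true_eq, Nat.div_div_eq_div_mul]
  have hA : 2 ^ A = 2 ^ (d * t) * 2 ^ (A - d * t) := by
    rw [← pow_add]; congr 1; omega
  rw [hA, Nat.mul_div_mul_right _ _ (by positivity)]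
  obtain ⟨Q, hQ⟩ := pow_form d t hd ht
  rw [hQ, Nat.mul_add_div (by omega), Nat.div_eq_of_lt (by omega)]
  omega

theorem goodDiv_of_prime (d : ℕ) (hd : d.Prime) : goodDiv d = true := by
  have key : ∀ e, 2 ≤ e → (d % e != 0 || d == e) = true := by
    intro e he
    by_cases h : d % e = 0
    · have := (Nat.dvd_prime hd).1 (Nat.dvd_of_mod_eq_zero h)
      have h2 : d = e := by omega
      simp [h2]
    · simp [h]
  unfold goodDiv
  rw [List.all_eq_true]
  intro e he
  apply key
  simp at he
  omega

theorem sieve_bit (J j t : ℕ) (hj : j < J) (hg : (2 * j + 3).Prime) (ht : 1 ≤ t)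
    (h : (j + 1) + (2 * j + 3) * t ≤ sieveL) :
    (sieve J).testBit (sieveL - ((j + 1) + (2 * j + 3) * t)) = true := by
  induction J with
  | zero => omega
  | succ J ih =>
    rcases Nat.lt_succ_iff_lt_or_eq.1 hj with hlt | rfl
    · unfold sieve
      split
      · rw [Nat.testBit_or, ih hlt, Bool.or_true]
      · exact ih hlt
    · unfold sieve
      rw [if_pos (goodDiv_of_prime _ hg), Nat.testBit_or]
      have := mask_bit (sieveL - (j + 1)) (2 * j + 3) t (by omega) ht (by omega)
      rw [Nat.sub_sub] at this
      rw [this, Bool.true_or]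

theorem bit_compl (S L p : ℕ) (hp : p ≤ L)
    (h : (S ^^^ (2 ^ (L + 1) - 1)).testBit p = true) : S.testBit p = false := by
  rw [Nat.testBit_xor, Nat.testBit_two_pow_sub_one] at h
  have : p < L + 1 := by omega
  simpa [this] using h

theorem prime_of_bit (i : ℕ) (hi : 1 ≤ i) (hL : i ≤ 1000000)
    (h : sieveZ.testBit (sieveL - i) = true) : (2 * i + 1).Prime := by
  have hS : (sieve 707).testBit (sieveL - i) = false :=
    bit_compl _ sieveL _ (Nat.sub_le _ _) h
  by_contra hn
  have hmp := Nat.minFac_prime (n := 2 * i + 1) (by omega)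
  have hsq := Nat.minFac_sq_le_self (n := 2 * i + 1) (by omega) hn
  have hdv := Nat.minFac_dvd (2 * i + 1)
  set d := (2 * i + 1).minFac with hd
  obtain ⟨k, hk⟩ := hdv
  have hdodd : d % 2 = 1 := by
    rcases Nat.mod_two_eq_zero_or_one d with h0 | h0
    · have : (d * k) % 2 = 0 := by rw [Nat.mul_mod, h0]; simp
      omega
    · exact h0
  have hkodd : k % 2 = 1 := by
    rcases Nat.mod_two_eq_zero_or_one k with h0 | h0
    · have : (d * k) % 2 = 0 := by rw [Nat.mul_mod, h0]; simp
      omega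
    · exact h0
  have hd2 := hmp.two_le
  have hd3 : 3 ≤ d := by omega
  obtain ⟨j, hj⟩ : ∃ j, d = 2 * j + 3 := ⟨(d - 3) / 2, by omega⟩
  obtain ⟨t, ht⟩ : ∃ t, k = 2 * t + 1 := ⟨k / 2, by omega⟩
  have ht1 : 1 ≤ t := by
    by_contra h0
    have : t = 0 := by omega
    subst this
    have : d = 2 * i + 1 := by rw [hk, ht]; ring
    rw [this] at hsq
    nlinarith
  have hj707 : j < 707 := by
    by_contra h0
    have : 1417 ≤ d := by omega
    nlinarith
  have hij : (j + 1) + (2 * j + 3) * t = i := by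
    rw [hj, ht] at hk
    nlinarith
  have := sieve_bit 707 j t hj707 (hj ▸ hmp) ht1 (by rw [hij]; exact hL)
  rw [hij, hS] at this
  exact Bool.noConfusion this

/-! ### Correctness of the bit count -/

/-- Sum of the `N` lowest base-`2 ^ w` digits. -/
def fs (w : ℕ) : ℕ → ℕ → ℕ
  | 0, _ => 0
  | N + 1, x => x % 2 ^ w + fs w N (x / 2 ^ w)

theorem mask_mul (w N : ℕ) : (2 ^ w + 1) ∣ 2 ^ (2 * w * N) - 1 := by
  have h1 : (2 ^ w + 1) ∣ 2 ^ (2 * w) - 1 := by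
    have := Nat.sq_sub_sq (2 ^ w) 1
    rw [one_pow, ← pow_mul, mul_comm w 2] at this
    rw [this]
    exact dvd_mul_right _ _
  have h2 := Nat.sub_dvd_pow_sub_pow (2 ^ (2 * w)) 1 N
  rw [one_pow, ← pow_mul] at h2
  exact h1.trans h2

theorem mask_succ (w N : ℕ) :
    (2 ^ (2 * w * (N + 1)) - 1) / (2 ^ w + 1) =
      2 ^ (2 * w) * ((2 ^ (2 * w * N) - 1) / (2 ^ w + 1)) + (2 ^ w - 1) := by
  obtain ⟨k, hk⟩ := mask_mul w N
  rw [hk, Nat.mul_div_cancel_left _ (by positivity)]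
  apply Nat.div_eq_of_eq_mul_right (by positivity)
  have h1 := Nat.one_le_two_pow (n := w)
  have h2 := Nat.one_le_two_pow (n := 2 * w * N)
  obtain ⟨r, hr⟩ : ∃ r, 2 ^ w = r + 1 := ⟨2 ^ w - 1, by omega⟩
  have h3 : 2 ^ (2 * w * N) = (2 ^ w + 1) * k + 1 := by omega
  have h4 : 2 ^ (2 * w) = 2 ^ w * 2 ^ w := by rw [two_mul, pow_add]
  rw [mul_add, pow_add, h3, mul_one, h4, hr]
  simp only [Nat.add_sub_cancel]
  rw [Nat.sub_eq_iff_eq_add (Nat.succ_le_of_lt (by positivity))]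
  ring

theorem land_mask (x w M : ℕ) :
    x &&& (2 ^ (2 * w) * M + (2 ^ w - 1)) = 2 ^ (2 * w) * ((x / 2 ^ (2 * w)) &&& M) + x % 2 ^ w := by
  have hw : 2 ^ w ≤ 2 ^ (2 * w) := Nat.pow_le_pow_right (by norm_num) (by omega)
  have h1 := Nat.one_le_two_pow (n := w)
  have h2 : x % 2 ^ w < 2 ^ (2 * w) := lt_of_lt_of_le (Nat.mod_lt _ (by positivity)) hw
  apply Nat.eq_of_testBit_eq
  intro i
  rw [Nat.testBit_and, Nat.testBit_two_pow_mul_add _ (by omega), Nat.testBit_two_pow_mul_add _ h2]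
  split
  · rw [Nat.testBit_two_pow_sub_one, Nat.testBit_mod_two_pow, Bool.and_comm]
  · rw [Nat.testBit_and, Nat.testBit_div_two_pow]
    congr 2
    omega

theorem step_succ (w N x : ℕ) :
    step w (N + 1) x =
      2 ^ (2 * w) * step w N (x / 2 ^ (2 * w)) + (x % 2 ^ w + (x / 2 ^ w) % 2 ^ w) := by
  unfold step
  rw [mask_succ, land_mask, land_mask]
  simp only [Nat.shiftRight_eq_div_pow]
  rw [Nat.div_div_eq_div_mul, Nat.div_div_eq_div_mul, mul_comm (2 ^ w) (2 ^ (2 * w))]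
  ring

theorem two_fields (w x : ℕ) (hw : 1 ≤ w) :
    x % 2 ^ w + (x / 2 ^ w) % 2 ^ w < 2 ^ (2 * w) := by
  have h1 := Nat.mod_lt x (show 0 < 2 ^ w by positivity)
  have h2 := Nat.mod_lt (x / 2 ^ w) (show 0 < 2 ^ w by positivity)
  have h3 : 2 ^ 1 ≤ 2 ^ w := Nat.pow_le_pow_right (by norm_num) hw
  rw [two_mul, pow_add]
  nlinarith

theorem fs_step (w N x : ℕ) (hw : 1 ≤ w) : fs (2 * w) N (step w N x) = fs w (2 * N) x := by
  induction N generalizing x with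
  | zero => rfl
  | succ N ih =>
    have h := two_fields w x hw
    have e : 2 * (N + 1) = (2 * N + 1) + 1 := by ring
    rw [step_succ, e]
    simp only [fs]
    rw [Nat.mul_add_mod, Nat.mod_eq_of_lt h, Nat.mul_add_div (by positivity),
      Nat.div_eq_of_lt h, add_zero, ih, Nat.div_div_eq_div_mul, ← pow_add, ← two_mul]
    ring

theorem step_lt (w N x : ℕ) (hw : 1 ≤ w) : step w N x < 2 ^ (2 * w * N) := by
  induction N generalizing x with
  | zero => simp [step]
  | succ N ih =>
    have h := two_fields w x hw
    rw [step_succ, mul_add, mul_one, pow_add]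
    have := Nat.mul_le_mul_left (2 ^ (2 * w)) (Nat.succ_le_of_lt (ih (x / 2 ^ (2 * w))))
    rw [Nat.mul_succ] at this
    rw [mul_comm (2 ^ (2 * w * N))]
    omega

theorem fs_modEq (w N x : ℕ) (hx : x < 2 ^ (w * N)) : x ≡ fs w N x [MOD 2 ^ w - 1] := by
  induction N generalizing x with
  | zero =>
    have : x = 0 := by simpa using hx
    subst this
    rfl
  | succ N ih =>
    have h1 : x / 2 ^ w < 2 ^ (w * N) := by
      rw [Nat.div_lt_iff_lt_mul (by positivity), ← pow_add]
      exact hx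
    have h2 : 2 ^ w ≡ 1 [MOD 2 ^ w - 1] := by
      have h3 := Nat.one_le_two_pow (n := w)
      exact ((Nat.modEq_iff_dvd' h3).2 dvd_rfl).symm
    have h4 : x % 2 ^ w + 2 ^ w * (x / 2 ^ w) ≡ x % 2 ^ w + 1 * fs w N (x / 2 ^ w)
        [MOD 2 ^ w - 1] := Nat.ModEq.add_left _ (Nat.ModEq.mul h2 (ih _ h1))
    rw [Nat.mod_add_div, one_mul] at h4
    exact h4

theorem fs_one (N x : ℕ) :
    fs 1 N x = ((Finset.range N).filter (fun i => x.testBit i = true)).card := by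
  rw [Finset.card_filter]
  induction N generalizing x with
  | zero => rfl
  | succ N ih =>
    rw [Finset.sum_range_succ']
    simp only [fs]
    rw [ih, add_comm]
    congr 1
    · refine Finset.sum_congr rfl fun i _ => ?_
      rw [pow_one, Nat.testBit_div_two]
    · rw [Nat.testBit_zero, pow_one]
      rcases Nat.mod_two_eq_zero_or_one x with h | h <;> simp [h]

theorem pop_le (K x : ℕ) :
    pop K x ≤ ((Finset.range (32 * K)).filter (fun i => x.testBit i = true)).card := by
  unfold pop
  have h := fs_modEq (2 * 16) K
    (step 16 K (step 8 (2 * K) (step 4 (4 * K) (step 2 (8 * K) (step 1 (16 * K) x)))))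
    (step_lt 16 K _ (by norm_num))
  rw [fs_step 16 _ _ (by norm_num)] at h
  have h8 := fs_step 8 (2 * K) (step 4 (4 * K) (step 2 (8 * K) (step 1 (16 * K) x))) (by norm_num)
  have h4 := fs_step 4 (4 * K) (step 2 (8 * K) (step 1 (16 * K) x)) (by norm_num)
  have h2 := fs_step 2 (8 * K) (step 1 (16 * K) x) (by norm_num)
  have h1 := fs_step 1 (16 * K) x (by norm_num)
  rw [show 2 * (2 * K) = 4 * K by ring] at h8
  rw [show 2 * (4 * K) = 8 * K by ring] at h4
  rw [show 2 * (8 * K) = 16 * K by ring] at h2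
  rw [show 2 * (16 * K) = 32 * K by ring] at h1
  norm_num only at h8 h4 h2 h1 h
  rw [h8, h4, h2, h1, fs_one] at h
  norm_num only
  unfold Nat.ModEq at h
  rw [h]
  exact Nat.mod_le _ _

/-- Number of primes in `[s, e]`. -/
theorem blkOk_card (s e c : ℕ) (h : blkOk s e c = true) :
    3 ≤ s ∧ s ≤ e ∧ c ≤ ((Finset.Icc s e).filter Nat.Prime).card := by
  unfold blkOk at h
  simp only [Bool.and_eq_true, decide_eq_true_eq] at h
  obtain ⟨⟨⟨⟨⟨h3, hs⟩, he⟩, hse⟩, hL⟩, hc⟩ := h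
  refine ⟨h3, hse, hc.trans ((pop_le _ _).trans ?_)⟩
  apply Finset.card_le_card_of_injOn (fun j => 2 * (e / 2 - j) + 1)
  · intro j hj
    simp only [Finset.coe_filter, Finset.mem_range, Set.mem_ofPred_eq, Nat.testBit_mod_two_pow,
      Bool.and_eq_true, decide_eq_true_eq, Nat.testBit_shiftRight] at hj
    obtain ⟨_, hj1, hj2⟩ := hj
    have hp := prime_of_bit (e / 2 - j) (by omega) (by omega) (by
      convert hj2 using 2
      unfold sieveL
      omega)
    simp only [Finset.coe_filter, Finset.mem_Icc, Set.mem_ofPred_eq]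
    exact ⟨by omega, hp⟩
  · intro j hj j' hj' hjj
    simp only [Finset.coe_filter, Finset.mem_range, Set.mem_ofPred_eq, Nat.testBit_mod_two_pow,
      Bool.and_eq_true, decide_eq_true_eq] at hj hj'
    simp only at hjj
    omega

/-! ### The harmonic table -/

theorem hOk_spec (n : ℕ) (h : hOk n = true) :
    ∀ k < n, hget (k + 1) = hget k + 10 ^ 8 / (k + 1) := by
  induction n with
  | zero => intro k hk; omega
  | succ n ih =>
    unfold hOk at h
    rw [Bool.and_eq_true, decide_eq_true_eq] at h
    intro k hk
    rcases Nat.lt_succ_iff_lt_or_eq.1 hk with h1 | rfl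
    · exact ih h.2 k h1
    · exact h.1

theorem hget_step (k : ℕ) :
    hget k ≤ hget (k + 1) ∧ hget (k + 1) ≤ hget k + 10 ^ 8 / (k + 1) := by
  by_cases hk : k < 2400
  · have := hOk_spec 2400 hOk_all k hk
    exact ⟨this ▸ Nat.le_add_right _ _, this.le⟩
  · have : hget (k + 1) = hget k := by
      unfold hget
      rw [Nat.sub_eq_zero_of_le (show 2400 ≤ k + 1 by omega),
        Nat.sub_eq_zero_of_le (show 2400 ≤ k by omega)]
    rw [this]
    exact ⟨le_rfl, Nat.le_add_right _ _⟩

theorem hget_mono : Monotone hget := monotone_nat_of_le_succ fun k => (hget_step k).1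

theorem hget_sum (u v : ℕ) (h : u ≤ v) :
    (hget v : ℝ) ≤ hget u + 10 ^ 8 * ∑ k ∈ Finset.Ioc u v, (1 : ℝ) / k := by
  induction v, h using Nat.le_induction with
  | base => simp
  | succ v hv ih =>
    rw [Finset.sum_Ioc_succ_top hv]
    have h1 : (hget (v + 1) : ℝ) ≤ hget v + ((10 ^ 8 / (v + 1) : ℕ) : ℝ) := by
      exact_mod_cast (hget_step v).2
    have h2 : ((10 ^ 8 / (v + 1) : ℕ) : ℝ) ≤ ((10 ^ 8 : ℕ) : ℝ) / ((v + 1 : ℕ) : ℝ) :=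
      Nat.cast_div_le
    have h3 : ((10 ^ 8 : ℕ) : ℝ) / ((v + 1 : ℕ) : ℝ) = 10 ^ 8 * (1 / ((v + 1 : ℕ) : ℝ)) := by
      push_cast
      ring
    rw [mul_add]
    linarith

theorem hget_sub (u v : ℕ) :
    ((hget v - hget u : ℕ) : ℝ) ≤ 10 ^ 8 * ∑ k ∈ Finset.Ioc u v, (1 : ℝ) / k := by
  rcases le_total u v with h | h
  · rw [Nat.cast_sub (hget_mono h)]
    linarith [hget_sum u v h]
  · rw [Nat.sub_eq_zero_of_le (hget_mono h)]
    simp only [Nat.cast_zero]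
    positivity

/-! ### The sum over non-smooth numbers -/

/-- The cofactors `k` with `m ≤ p * k ≤ 10 * m`. -/
def cof (m p : ℕ) : Finset ℕ :=
  (Finset.Icc 1 (10 * m)).filter (fun k => m ≤ p * k ∧ p * k ≤ 10 * m)

/-- Sum of `1 / n` over the multiples `n` of `p` in the interval. -/
noncomputable def F (m p : ℕ) : ℝ := ∑ k ∈ cof m p, (1 : ℝ) / ((p * k : ℕ) : ℝ)

theorem F_nonneg (m p : ℕ) : 0 ≤ F m p := by
  unfold F
  positivity

theorem F_lb (a b m s e p : ℕ) (ha : a ≤ m) (hb : m ≤ b) (hs : 1 ≤ s)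
    (hp : s ≤ p) (he : p ≤ e) :
    ((hget (10 * a / e) - hget ((b - 1) / s) : ℕ) : ℝ) / e ≤ 10 ^ 8 * F m p := by
  have hsub : Finset.Ioc ((b - 1) / s) (10 * a / e) ⊆ cof m p := by
    intro k hk
    rw [Finset.mem_Ioc, Nat.div_lt_iff_lt_mul (by omega), Nat.le_div_iff_mul_le (by omega)] at hk
    obtain ⟨h1, h2⟩ := hk
    have hk1 : 1 ≤ k := by
      rcases Nat.eq_zero_or_pos k with h0 | h0
      · subst h0; omega
      · exact h0
    have h3 : k * s ≤ p * k := by rw [mul_comm p]; exact Nat.mul_le_mul_left _ hp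
    have h4 : p * k ≤ k * e := by rw [mul_comm p]; exact Nat.mul_le_mul_left _ he
    have h5 : k * 1 ≤ k * e := Nat.mul_le_mul_left _ (by omega)
    unfold cof
    rw [Finset.mem_filter, Finset.mem_Icc]
    omega
  have h1 : ∑ k ∈ Finset.Ioc ((b - 1) / s) (10 * a / e), (1 : ℝ) / k / e ≤ F m p := by
    unfold F
    refine le_trans (Finset.sum_le_sum fun k hk => ?_)
      (Finset.sum_le_sum_of_subset_of_nonneg hsub fun k _ _ => by positivity)
    have hk0 : 0 < k := lt_of_le_of_lt (Nat.zero_le _) (Finset.mem_Ioc.1 hk).1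
    rw [div_div]
    apply one_div_le_one_div_of_le
    · have : 0 < p * k := Nat.mul_pos (by omega) hk0
      exact_mod_cast this
    · have : p * k ≤ k * e := by rw [mul_comm p]; exact Nat.mul_le_mul_left _ he
      exact_mod_cast this
  rw [← Finset.sum_div] at h1
  have h2 := hget_sub ((b - 1) / s) (10 * a / e)
  have he0 : (0 : ℝ) < e := by
    have : 0 < e := by omega
    exact_mod_cast this
  calc _ ≤ (10 ^ 8 * ∑ k ∈ Finset.Ioc ((b - 1) / s) (10 * a / e), (1 : ℝ) / k) / e := by
        gcongr
    _ = 10 ^ 8 * ((∑ k ∈ Finset.Ioc ((b - 1) / s) (10 * a / e), (1 : ℝ) / k) / e) := by ring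
    _ ≤ _ := by gcongr

/-- The primes that are used. -/
def usedP (m q s2 x : ℕ) : Finset ℕ :=
  (Finset.range (10 * m + 1)).filter (fun p => p.Prime ∧ (p = q ∨ s2 ≤ p) ∧ x ≤ p)

theorem ev_le (a b m q s2 : ℕ) (ha : a ≤ m) (hb : m ≤ b) (l : List (ℕ × ℕ × ℕ)) (x : ℕ)
    (h : blksOk x l = true) :
    (ev a b q s2 l : ℝ) ≤ 10 ^ 8 * ∑ p ∈ usedP m q s2 x, F m p := by
  induction l generalizing x with
  | nil =>
    simp only [ev, Nat.cast_zero]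
    have : 0 ≤ ∑ p ∈ usedP m q s2 x, F m p := Finset.sum_nonneg fun p _ => F_nonneg m p
    positivity
  | cons y t ih =>
    obtain ⟨s, e, c⟩ := y
    simp only [blksOk, Bool.and_eq_true, decide_eq_true_eq] at h
    obtain ⟨⟨hx, hblk⟩, ht⟩ := h
    have iht := ih _ ht
    obtain ⟨h3, hse, hc⟩ := blkOk_card s e c hblk
    have hmono : ∑ p ∈ usedP m q s2 (e + 1), F m p ≤ ∑ p ∈ usedP m q s2 x, F m p := by
      apply Finset.sum_le_sum_of_subset_of_nonneg
      · intro p hp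
        simp only [usedP, Finset.mem_filter] at hp ⊢
        exact ⟨hp.1, hp.2.1, hp.2.2.1, by omega⟩
      · intro p _ _
        exact F_nonneg m p
    simp only [ev]
    cases hea : Nat.ble e (10 * a) with
    | false =>
      simp only [cond_false, Nat.cast_zero]
      have : 0 ≤ ∑ p ∈ usedP m q s2 x, F m p := Finset.sum_nonneg fun p _ => F_nonneg m p
      positivity
    | true =>
      have hea' := Nat.le_of_ble_eq_true hea
      simp only [cond_true]
      cases hq : ((Nat.beq s q && Nat.beq e q) || Nat.ble s2 s) with
      | false =>
        simp only [cond_false, zero_add]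
        linarith
      | true =>
        simp only [cond_true]
        rw [Bool.or_eq_true, Bool.and_eq_true] at hq
        have hq' : (s = q ∧ e = q) ∨ s2 ≤ s := by
          rcases hq with hq | hq
          · exact Or.inl ⟨Nat.eq_of_beq_eq_true hq.1, Nat.eq_of_beq_eq_true hq.2⟩
          · exact Or.inr (Nat.le_of_ble_eq_true hq)
        have hdisj : Disjoint ((Finset.Icc s e).filter Nat.Prime) (usedP m q s2 (e + 1)) := by
          rw [Finset.disjoint_left]
          intro p hp hp'
          simp only [usedP, Finset.mem_filter, Finset.mem_Icc] at hp hp'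
          omega
        have hun : ((Finset.Icc s e).filter Nat.Prime) ∪ (usedP m q s2 (e + 1)) ⊆
            usedP m q s2 x := by
          intro p hp
          rw [Finset.mem_union] at hp
          simp only [usedP, Finset.mem_filter, Finset.mem_Icc, Finset.mem_range] at hp ⊢
          rcases hp with ⟨hp1, hp2⟩ | ⟨hp1, hp2, hp3, hp4⟩
          · exact ⟨by omega, hp2, by omega, by omega⟩
          · exact ⟨hp1, hp2, hp3, by omega⟩
        have h5 : ∑ p ∈ (Finset.Icc s e).filter Nat.Prime, F m p +
            ∑ p ∈ usedP m q s2 (e + 1), F m p ≤ ∑ p ∈ usedP m q s2 x, F m p := by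
          rw [← Finset.sum_union hdisj]
          exact Finset.sum_le_sum_of_subset_of_nonneg hun fun p _ _ => F_nonneg m p
        have h6 : (c : ℝ) * (((hget (10 * a / e) - hget ((b - 1) / s) : ℕ) : ℝ) / e) ≤
            10 ^ 8 * ∑ p ∈ (Finset.Icc s e).filter Nat.Prime, F m p := by
          rw [Finset.mul_sum]
          calc _ ≤ (((Finset.Icc s e).filter Nat.Prime).card : ℝ) *
                (((hget (10 * a / e) - hget ((b - 1) / s) : ℕ) : ℝ) / e) := by
                gcongr
            _ = ∑ p ∈ (Finset.Icc s e).filter Nat.Prime,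
                (((hget (10 * a / e) - hget ((b - 1) / s) : ℕ) : ℝ) / e) := by
                rw [Finset.sum_const, nsmul_eq_mul]
            _ ≤ _ := by
                refine Finset.sum_le_sum fun p hp => ?_
                rw [Finset.mem_filter, Finset.mem_Icc] at hp
                exact F_lb a b m s e p ha hb (by omega) hp.1.1 hp.1.2
        have h7 : ((c * (hget (10 * a / e) - hget ((b - 1) / s)) / e : ℕ) : ℝ) ≤
            (c : ℝ) * (((hget (10 * a / e) - hget ((b - 1) / s) : ℕ) : ℝ) / e) := by
          refine Nat.cast_div_le.trans (le_of_eq ?_)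
          rw [Nat.cast_mul, mul_div_assoc]
        rw [Nat.cast_add]
        linarith

theorem maxPrimeFac_ge (n p : ℕ) (hn : n ≠ 0) (hp : p.Prime) (h : p ∣ n) :
    p ≤ maxPrimeFac n := by
  unfold maxPrimeFac
  refine le_max_of_le_right ?_
  exact Finset.le_sup (f := id) (Nat.mem_primeFactors.2 ⟨hp, h, hn⟩)

open scoped Classical in
theorem sum_F_le (m b q s2 x : ℕ) (hm : 1 ≤ m) (hb : m ≤ b) (hq : 9 * b + 1 ≤ q * q)
    (hqs : q ≤ s2) (hqs2 : 10 * b < q * s2) :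
    ∑ p ∈ usedP m q s2 x, F m p ≤
      ∑ n ∈ (Finset.Icc m (10 * m)).filter
        (fun n => ¬ (maxPrimeFac n : ℝ) < Real.sqrt (9 * (m : ℝ) + 1)), (1 : ℝ) / n := by
  unfold F
  rw [Finset.sum_sigma']
  have hinj : Set.InjOn (fun y : (_ : ℕ) × ℕ => y.1 * y.2)
      ((usedP m q s2 x).sigma (fun p => cof m p) : Finset _) := by
    rintro ⟨p, k⟩ h1 ⟨p', k'⟩ h2 heq
    simp only [Finset.mem_coe, Finset.mem_sigma, usedP, cof, Finset.mem_filter,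
      Finset.mem_Icc, Finset.mem_range] at h1 h2
    simp only at heq
    obtain ⟨⟨_, hp, hpq, _⟩, ⟨hk, _⟩, _, hk2⟩ := h1
    obtain ⟨⟨_, hp', hpq', _⟩, _⟩ := h2
    by_cases hpp : p = p'
    · subst hpp
      have := Nat.eq_of_mul_eq_mul_left hp.pos heq
      subst this
      rfl
    · exfalso
      have hcop : Nat.Coprime p p' := (Nat.coprime_primes hp hp').2 hpp
      have hdvd : p * p' ∣ p * k :=
        hcop.mul_dvd_of_dvd_of_dvd (dvd_mul_right _ _) (heq ▸ dvd_mul_right _ _)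
      have hle := Nat.le_of_dvd (Nat.mul_pos hp.pos hk) hdvd
      have hge : q * s2 ≤ p * p' := by
        rcases hpq with rfl | hpq
        · rcases hpq' with rfl | hpq'
          · exact absurd rfl hpp
          · exact Nat.mul_le_mul_left _ hpq'
        · rw [mul_comm]
          exact Nat.mul_le_mul hpq (by omega)
      omega
  rw [← Finset.sum_image (f := fun n : ℕ => (1 : ℝ) / n) hinj]
  apply Finset.sum_le_sum_of_subset_of_nonneg
  · intro n hn
    rw [Finset.mem_image] at hn
    obtain ⟨⟨p, k⟩, h1, rfl⟩ := hn
    simp only [Finset.mem_sigma, usedP, cof, Finset.mem_filter,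
      Finset.mem_Icc, Finset.mem_range] at h1
    obtain ⟨⟨_, hp, hpq, _⟩, ⟨hk, _⟩, hk1, hk2⟩ := h1
    rw [Finset.mem_filter, Finset.mem_Icc]
    refine ⟨⟨hk1, hk2⟩, ?_⟩
    rw [not_lt]
    have hpk : p * k ≠ 0 := by show p * k ≠ 0; omega
    have h2 := maxPrimeFac_ge (p * k) p hpk hp (dvd_mul_right _ _)
    have h3 : q ≤ maxPrimeFac (p * k) := by omega
    have h4 : 9 * m + 1 ≤ maxPrimeFac (p * k) * maxPrimeFac (p * k) :=
      le_trans (by omega) (Nat.mul_le_mul h3 h3)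
    apply Real.sqrt_le_iff.2
    refine ⟨Nat.cast_nonneg _, ?_⟩
    rw [sq]
    exact_mod_cast h4
  · intro n _ _
    positivity

/-! ### The full harmonic sum -/

theorem hup_le (m : ℕ) (k : ℕ) :
    10 ^ 12 * ∑ n ∈ Finset.Ico m (m + k), (1 : ℝ) / n ≤ hup m k := by
  induction k with
  | zero => simp [hup]
  | succ k ih =>
    rw [← add_assoc, Finset.sum_Ico_succ_top (by omega), mul_add]
    simp only [hup]
    have h1 : ((10 ^ 12 : ℕ) : ℝ) / ((m + k : ℕ) : ℝ) < ((10 ^ 12 / (m + k) : ℕ) : ℝ) + 1 := by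
      have := Nat.lt_floor_add_one (((10 ^ 12 : ℕ) : ℝ) / ((m + k : ℕ) : ℝ))
      rwa [Nat.floor_div_eq_div] at this
    have h2 : ((10 ^ 12 : ℕ) : ℝ) / ((m + k : ℕ) : ℝ) = 10 ^ 12 * (1 / ((m + k : ℕ) : ℝ)) := by
      rw [Nat.cast_pow, Nat.cast_ofNat]
      ring
    rw [h2] at h1
    rw [Nat.cast_add (10 ^ 12 / (m + k) + 1), Nat.cast_add (10 ^ 12 / (m + k)), Nat.cast_one]
    linarith

theorem S_anti (m : ℕ) (hm : 117 ≤ m) :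
    ∑ n ∈ Finset.Ico m (10 * m + 1), (1 : ℝ) / n ≤
      ∑ n ∈ Finset.Ico (117 : ℕ) (10 * 117 + 1), (1 : ℝ) / n := by
  induction m, hm using Nat.le_induction with
  | base => exact le_rfl
  | succ m hm ih =>
    refine le_trans ?_ ih
    have h0 : (0 : ℝ) < m := by
      have : 0 < m := by omega
      exact_mod_cast this
    rw [Finset.sum_eq_sum_Ico_succ_bot (show m < 10 * m + 1 by omega)]
    have e : 10 * (m + 1) + 1 = (10 * m + 1) + 10 := by ring
    rw [e, ← Finset.sum_Ico_consecutive _ (show m + 1 ≤ 10 * m + 1 by omega)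
      (show 10 * m + 1 ≤ (10 * m + 1) + 10 by omega)]
    have h1 : ∑ n ∈ Finset.Ico (10 * m + 1) (10 * m + 1 + 10), (1 : ℝ) / n ≤
        ∑ n ∈ Finset.Ico (10 * m + 1) (10 * m + 1 + 10), (1 : ℝ) / (10 * m) := by
      refine Finset.sum_le_sum fun n hn => ?_
      rw [Finset.mem_Ico] at hn
      apply one_div_le_one_div_of_le (by positivity)
      have : 10 * m ≤ n := by omega
      exact_mod_cast this
    rw [Finset.sum_const, Nat.card_Ico, nsmul_eq_mul, Nat.add_sub_cancel_left] at h1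
    have h2 : ((10 : ℕ) : ℝ) * (1 / (10 * m)) = 1 / m := by
      push_cast
      field_simp
    rw [h2] at h1
    linarith

theorem S_le (m : ℕ) (hm : 117 ≤ m) :
    ∑ n ∈ Finset.Icc m (10 * m), (1 : ℝ) / n ≤ 2.3073 := by
  have h1 := S_anti m hm
  have h2 := hup_le 117 1054
  have h3 : (hup 117 1054 : ℝ) ≤ 2307300000000 := by exact_mod_cast hup_117
  have e : Finset.Icc m (10 * m) = Finset.Ico m (10 * m + 1) := by
    ext n
    simp only [Finset.mem_Icc, Finset.mem_Ico]
    omega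
  rw [e]
  norm_num only at h1 h2 h3 ⊢
  linarith

theorem winsOk_spec (l : List (ℕ × ℕ × ℕ)) (a m : ℕ) (h : winsOk a l = true) (ham : a ≤ m)
    (hm : m ≤ 616000) :
    ∃ a' b q s2, a' ≤ m ∧ m ≤ b ∧ 9 * b + 1 ≤ q * q ∧ q ≤ s2 ∧ 10 * b < q * s2 ∧
      130730000 < ev a' b q s2 blk := by
  induction l generalizing a with
  | nil =>
    unfold winsOk at h
    rw [decide_eq_true_eq] at h
    omega
  | cons y t ih =>
    obtain ⟨b, q, s2⟩ := y
    unfold winsOk at h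
    simp only [Bool.and_eq_true, decide_eq_true_eq] at h
    obtain ⟨⟨⟨⟨h1, h2⟩, h3⟩, h4⟩, h5⟩ := h
    by_cases hmb : m ≤ b
    · exact ⟨a, b, q, s2, ham, hmb, h1, h2, h3, h4⟩
    · exact ih (b + 1) h5 (by omega)

/-- For every integer `m` with `117 ≤ m ≤ 616000`, `T m < 1`. -/
theorem T_lt_one (m : ℕ) (h1 : 117 ≤ m) (h2 : m ≤ 616000) : T m < 1 := by
  classical
  obtain ⟨a, b, q, s2, ha, hb, hq, hqs, hqs2, hev⟩ := winsOk_spec wins 117 m winsOk_wins h1 h2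
  have hF := ev_le a b m q s2 ha hb blk 3 blksOk_blk
  have hN := sum_F_le m b q s2 3 (by omega) hb hq hqs hqs2
  have hS := S_le m h1
  rw [← Finset.sum_filter_add_sum_filter_not (Finset.Icc m (10 * m))
    (fun n => (maxPrimeFac n : ℝ) < Real.sqrt (9 * (m : ℝ) + 1))] at hS
  have hev' : (130730000 : ℝ) < ev a b q s2 blk := by exact_mod_cast hev
  unfold T
  norm_num only at hF hS ⊢
  linarith
end

section
/- For any real number K > 1 there exists N_0 (depending on K) such that for all N ≥ N_0 there is no covering system with pairwise distinct moduli all lying in the interval (N, K·N]. -/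
/-- A covering system: a finite set of congruences `x ≡ a (mod n)`, encoded as pairs
`(a, n) : ℤ × ℕ`, with positive moduli, such that every integer satisfies at least one
of the congruences. -/
def IsCoveringSystem (C : Finset (ℤ × ℕ)) : Prop :=
  (∀ c ∈ C, 0 < c.2) ∧ ∀ x : ℤ, ∃ c ∈ C, x ≡ c.1 [ZMOD (c.2 : ℤ)]

/-- The moduli of the congruences in `C` are pairwise distinct. -/
def HasDistinctModuli (C : Finset (ℤ × ℕ)) : Prop :=
  ∀ c ∈ C, ∀ c' ∈ C, c ≠ c' → c.2 ≠ c'.2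

/-- A distinct covering system: a covering system whose moduli are pairwise distinct
and all greater than `1`. -/
def IsDistinctCoveringSystem (C : Finset (ℤ × ℕ)) : Prop :=
  IsCoveringSystem C ∧ (∀ c ∈ C, 1 < c.2) ∧ HasDistinctModuli C


/-- Real-valued indicator of a proposition. -/
noncomputable def ind (P : Prop) : ℝ := open Classical in if P then 1 else 0

lemma ind_true {P : Prop} (h : P) : ind P = 1 := by simp [ind, h]
lemma ind_false {P : Prop} (h : ¬ P) : ind P = 0 := by simp [ind, h]
lemma ind_nonneg (P : Prop) : 0 ≤ ind P := by unfold ind; split_ifs <;> norm_num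
lemma ind_le_one (P : Prop) : ind P ≤ 1 := by unfold ind; split_ifs <;> norm_num
lemma ind_mono {P R : Prop} (h : P → R) : ind P ≤ ind R := by
  by_cases hP : P
  · rw [ind_true hP, ind_true (h hP)]
  · rw [ind_false hP]; exact ind_nonneg _
lemma ind_congr {P R : Prop} (h : P ↔ R) : ind P = ind R := by rw [propext h]
lemma ind_or_le (P R : Prop) : ind (P ∨ R) ≤ ind P + ind R := by
  by_cases hP : P <;> by_cases hR : R <;> simp [ind, hP, hR]
lemma ind_exists_le {ι : Type*} (s : Finset ι) (P : ι → Prop) :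
    ind (∃ i ∈ s, P i) ≤ ∑ i ∈ s, ind (P i) := by
  by_cases h : ∃ i ∈ s, P i
  · obtain ⟨i, hi, hP⟩ := h
    rw [ind_true ⟨i, hi, hP⟩, ← ind_true hP]
    exact Finset.single_le_sum (f := fun i => ind (P i)) (fun j _ => ind_nonneg _) hi
  · rw [ind_false h]; exact Finset.sum_nonneg (fun j _ => ind_nonneg _)

lemma sum_range_fibre (Q q : ℕ) (f : ℕ → ℝ) :
    ∑ y ∈ Finset.range (Q * q), f y =
      ∑ x ∈ Finset.range Q, ∑ t ∈ Finset.range q, f (x + t * Q) := by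
  rw [Finset.sum_comm]
  induction q with
  | zero => simp
  | succ q ih =>
    rw [Finset.sum_range_succ, ← ih, Nat.mul_succ, Finset.sum_range_add]
    congr 1
    apply Finset.sum_congr rfl
    intro x _
    congr 1
    ring

/-- Among `t < r * k`, at most `k` satisfy `x + t Q ≡ a (mod r)`, when `r` and `Q` are coprime. -/
lemma sum_ind_le (Q r k : ℕ) (hc : Nat.Coprime r Q) (x : ℕ) (a : ℤ) :
    ∑ t ∈ Finset.range (r * k), ind (((x + t * Q : ℕ) : ℤ) ≡ a [ZMOD (r : ℤ)]) ≤ k := by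
  classical
  have h1 : ∑ t ∈ Finset.range (r * k), ind (((x + t * Q : ℕ) : ℤ) ≡ a [ZMOD (r : ℤ)]) =
      (((Finset.range (r * k)).filter
        (fun t : ℕ => ((x + t * Q : ℕ) : ℤ) ≡ a [ZMOD (r : ℤ)])).card : ℝ) := by
    rw [Finset.card_filter]
    push_cast
    apply Finset.sum_congr rfl
    intro t _
    unfold ind
    split_ifs <;> rfl
  rw [h1]
  have h2 : ((Finset.range (r * k)).filter
        (fun t : ℕ => ((x + t * Q : ℕ) : ℤ) ≡ a [ZMOD (r : ℤ)])).card ≤ (Finset.range k).card := by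
    apply Finset.card_le_card_of_injOn (fun t => t / r)
    · intro t ht
      simp only [Finset.coe_filter, Finset.mem_range, Set.mem_ofPred_eq] at ht
      simp only [Finset.coe_range, Set.mem_Iio]
      exact Nat.div_lt_of_lt_mul ht.1
    · intro t ht t' ht' heq
      simp only [Finset.coe_filter, Finset.mem_range, Set.mem_ofPred_eq] at ht ht'
      have h3 : ((x + t * Q : ℕ) : ℤ) ≡ ((x + t' * Q : ℕ) : ℤ) [ZMOD (r : ℤ)] :=
        ht.2.trans ht'.2.symm
      rw [Int.natCast_modEq_iff] at h3
      have h4 := Nat.ModEq.add_left_cancel' x h3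
      have h5 : t ≡ t' [MOD r] := Nat.ModEq.cancel_right_of_coprime (by simpa using hc) h4
      have h6 : t % r = t' % r := h5
      simp only at heq
      rw [← Nat.div_add_mod t r, ← Nat.div_add_mod t' r, heq, h6]
  rw [Finset.card_range] at h2
  exact_mod_cast h2

/-- The number-of-divisors function, real-valued. -/
noncomputable def tau (m : ℕ) : ℝ := (m.divisors.card : ℝ)

lemma tau_nonneg (m : ℕ) : 0 ≤ tau m := by unfold tau; positivity

lemma tau_mul {m n : ℕ} (h : m.Coprime n) : tau (m * n) = tau m * tau n := by
  unfold tau; rw [h.card_divisors_mul]; push_cast; ring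

lemma tau_prime_pow {p : ℕ} (hp : p.Prime) (e : ℕ) : tau (p ^ e) = e + 1 := by
  unfold tau; rw [Nat.divisors_prime_pow hp]; simp

/-- A weight on `range Q` which is controlled on arithmetic progressions. -/
structure IsState (C : Finset (ℤ × ℕ)) (Q : ℕ) (β : ℝ) (ρ : ℕ → ℝ) : Prop where
  nonneg : ∀ x, 0 ≤ ρ x
  total : ∑ x ∈ Finset.range Q, ρ x = 1
  prog : ∀ m, m ∣ Q → ∀ a : ℤ,
    ∑ x ∈ Finset.range Q, ρ x * ind ((x : ℤ) ≡ a [ZMOD (m : ℤ)]) ≤ tau m / m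
  bad : ∑ x ∈ Finset.range Q, ρ x * ind (∃ c ∈ C, c.2 ∣ Q ∧ (x : ℤ) ≡ c.1 [ZMOD (c.2 : ℤ)]) ≤ β

lemma modEq_shift {Q m : ℕ} (h : m ∣ Q) (x t : ℕ) (a : ℤ) :
    ((x + t * Q : ℕ) : ℤ) ≡ a [ZMOD (m : ℤ)] ↔ (x : ℤ) ≡ a [ZMOD (m : ℤ)] := by
  have h1 : ((x + t * Q : ℕ) : ℤ) ≡ (x : ℤ) [ZMOD (m : ℤ)] := by
    rw [Int.natCast_modEq_iff]
    have : t * Q ≡ 0 [MOD m] := (Nat.modEq_zero_iff_dvd).2 (h.mul_left t)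
    simpa using this.add_left x
  exact ⟨fun h => h1.symm.trans h, fun h => h1.trans h⟩

lemma count_prog (Q r k n : ℕ) (hr : 0 < r) (hk : 0 < k) (hc : Nat.Coprime r Q) (hn : n ∣ Q)
    (x : ℕ) (a : ℤ) :
    (∑ t ∈ Finset.range (r * k), ind (((x + t * Q : ℕ) : ℤ) ≡ a [ZMOD ((n * r : ℕ) : ℤ)]))
      / ((r * k : ℕ) : ℝ) ≤ ind ((x : ℤ) ≡ a [ZMOD (n : ℤ)]) / r := by
  have hr' : (0 : ℝ) < r := by exact_mod_cast hr
  have hk' : (0 : ℝ) < k := by exact_mod_cast hk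
  by_cases h : (x : ℤ) ≡ a [ZMOD (n : ℤ)]
  · rw [ind_true h]
    have h1 : (∑ t ∈ Finset.range (r * k),
        ind (((x + t * Q : ℕ) : ℤ) ≡ a [ZMOD ((n * r : ℕ) : ℤ)])) ≤ k := by
      refine le_trans (Finset.sum_le_sum fun t _ => ?_) (sum_ind_le Q r k hc x a)
      apply ind_mono
      intro h
      apply h.of_dvd
      push_cast
      exact dvd_mul_left _ _
    have h2 : ((r * k : ℕ) : ℝ) = r * k := Nat.cast_mul r k
    rw [h2, div_le_div_iff₀ (by positivity) hr']
    have h3 := mul_le_mul_of_nonneg_right h1 hr'.le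
    linarith
  · rw [ind_false h]
    have h1 : (∑ t ∈ Finset.range (r * k),
        ind (((x + t * Q : ℕ) : ℤ) ≡ a [ZMOD ((n * r : ℕ) : ℤ)])) = 0 := by
      apply Finset.sum_eq_zero
      intro t _
      apply ind_false
      intro h'
      apply h
      rw [← modEq_shift hn x t a]
      apply h'.of_dvd
      push_cast
      exact dvd_mul_right _ _
    rw [h1]; simp

/-- The distortion factor: conditional average one, bounded by two. -/
lemma exists_distortion (q : ℕ) (hq : 0 < q) (B : ℕ → Prop) :
    ∃ g : ℕ → ℝ, (∀ t, 0 ≤ g t) ∧ (∀ t, g t ≤ 2) ∧ ∑ t ∈ Finset.range q, g t = q ∧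
      ∑ t ∈ Finset.range q, g t * ind (B t) ≤
        2 * q * ((∑ t ∈ Finset.range q, ind (B t)) / q) ^ 2 := by
  set α : ℝ := (∑ t ∈ Finset.range q, ind (B t)) / q with hα
  have hq' : (0 : ℝ) < q := by exact_mod_cast hq
  have hsum : ∑ t ∈ Finset.range q, ind (B t) = q * α := by rw [hα]; field_simp
  have hα0 : 0 ≤ α := div_nonneg (Finset.sum_nonneg fun t _ => ind_nonneg _) hq'.le
  by_cases h : α < 1 / 2
  · refine ⟨fun t => (1 - ind (B t)) / (1 - α), ?_, ?_, ?_, ?_⟩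
    · intro t
      exact div_nonneg (by linarith [ind_le_one (B t)]) (by linarith)
    · intro t
      rw [div_le_iff₀ (by linarith)]
      linarith [ind_nonneg (B t)]
    · rw [← Finset.sum_div, Finset.sum_sub_distrib, hsum]
      simp only [Finset.sum_const, Finset.card_range, nsmul_eq_mul, mul_one]
      rw [div_eq_iff (by linarith)]; ring
    · have : ∑ t ∈ Finset.range q, (1 - ind (B t)) / (1 - α) * ind (B t) = 0 := by
        apply Finset.sum_eq_zero
        intro t _
        by_cases hB : B t
        · simp [ind_true hB]
        · simp [ind_false hB]
      rw [this]; positivity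
  · refine ⟨fun _ => 1, by simp, by simp, by simp, ?_⟩
    simp only [one_mul]
    rw [hsum]
    push Not at h
    nlinarith [mul_nonneg hq'.le hα0]

lemma prog_lcm {C : Finset (ℤ × ℕ)} {Q : ℕ} {β : ℝ} {ρ : ℕ → ℝ} (hS : IsState C Q β ρ)
    {m n : ℕ} (hm : m ∣ Q) (hn : n ∣ Q) (a b : ℤ) :
    ∑ x ∈ Finset.range Q, ρ x * (ind ((x : ℤ) ≡ a [ZMOD (m : ℤ)]) *
      ind ((x : ℤ) ≡ b [ZMOD (n : ℤ)])) ≤ tau (m.lcm n) / (m.lcm n : ℕ) := by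
  by_cases h : ∃ z : ℤ, z ≡ a [ZMOD (m : ℤ)] ∧ z ≡ b [ZMOD (n : ℤ)]
  · obtain ⟨z, hz1, hz2⟩ := h
    refine le_trans (Finset.sum_le_sum fun x _ => ?_) (hS.prog _ (Nat.lcm_dvd hm hn) z)
    apply mul_le_mul_of_nonneg_left _ (hS.nonneg x)
    by_cases h1 : (x : ℤ) ≡ a [ZMOD (m : ℤ)]
    · by_cases h2 : (x : ℤ) ≡ b [ZMOD (n : ℤ)]
      · rw [ind_true h1, ind_true h2, ind_true]
        · norm_num
        · have e1 := (h1.trans hz1.symm).symm.dvd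
          have e2 := (h2.trans hz2.symm).symm.dvd
          apply Int.ModEq.symm
          rw [Int.modEq_iff_dvd]
          have := Int.coe_lcm_dvd e1 e2
          simpa [Int.lcm] using this
      · rw [ind_false h2]; simp [ind_nonneg]
    · rw [ind_false h1]; simp [ind_nonneg]
  · have : ∑ x ∈ Finset.range Q, ρ x * (ind ((x : ℤ) ≡ a [ZMOD (m : ℤ)]) *
      ind ((x : ℤ) ≡ b [ZMOD (n : ℤ)])) = 0 := by
      apply Finset.sum_eq_zero
      intro x _
      by_cases h1 : (x : ℤ) ≡ a [ZMOD (m : ℤ)]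
      · by_cases h2 : (x : ℤ) ≡ b [ZMOD (n : ℤ)]
        · exact absurd ⟨x, h1, h2⟩ h
        · rw [ind_false h2]; simp
      · rw [ind_false h1]; simp
    rw [this]
    exact div_nonneg (tau_nonneg _) (by positivity)

/-- The divisor sum controlling second moments. -/
noncomputable def divSum (Q : ℕ) : ℝ := ∑ l ∈ Q.divisors, tau l ^ 3 / l

lemma lcm_sum_le (Q : ℕ) :
    ∑ m ∈ Q.divisors, ∑ n ∈ Q.divisors, tau (m.lcm n) / (m.lcm n : ℕ) ≤ divSum Q := by
  classical
  rw [← Finset.sum_product']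
  have hmap : ∀ i ∈ Q.divisors ×ˢ Q.divisors, i.1.lcm i.2 ∈ Q.divisors := by
    intro i hi
    simp only [Finset.mem_product, Nat.mem_divisors] at hi ⊢
    exact ⟨Nat.lcm_dvd hi.1.1 hi.2.1, hi.1.2⟩
  rw [← Finset.sum_fiberwise_of_maps_to hmap]
  unfold divSum
  apply Finset.sum_le_sum
  intro l hl
  have hl0 : l ≠ 0 := fun h => by simp [h] at hl
  have h1 : ∑ i ∈ Q.divisors ×ˢ Q.divisors with i.1.lcm i.2 = l,
      tau (i.1.lcm i.2) / (i.1.lcm i.2 : ℕ) =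
      ∑ i ∈ Q.divisors ×ˢ Q.divisors with i.1.lcm i.2 = l, tau l / l := by
    apply Finset.sum_congr rfl
    intro i hi
    rw [(Finset.mem_filter.1 hi).2]
  rw [h1, Finset.sum_const, nsmul_eq_mul]
  have h2 : ((Q.divisors ×ˢ Q.divisors).filter (fun i => i.1.lcm i.2 = l)).card ≤
      (l.divisors ×ˢ l.divisors).card := by
    apply Finset.card_le_card
    intro i hi
    have := (Finset.mem_filter.1 hi).2
    simp only [Finset.mem_product, Nat.mem_divisors]
    exact ⟨⟨this ▸ Nat.dvd_lcm_left _ _, hl0⟩, ⟨this ▸ Nat.dvd_lcm_right _ _, hl0⟩⟩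
  rw [Finset.card_product] at h2
  have h3 : (((Q.divisors ×ˢ Q.divisors).filter (fun i => i.1.lcm i.2 = l)).card : ℝ) ≤
      tau l * tau l := by
    unfold tau; exact_mod_cast h2
  calc _ ≤ (tau l * tau l) * (tau l / l) :=
        mul_le_mul_of_nonneg_right h3 (div_nonneg (tau_nonneg _) (by positivity))
    _ = _ := by ring

lemma geom_bound {p : ℕ} (hp : 2 ≤ p) (γ : ℕ) :
    ∑ e ∈ Finset.Icc 1 γ, (1 : ℝ) / (p : ℝ) ^ e ≤ 2 / p := by
  have hp' : (2 : ℝ) ≤ p := by exact_mod_cast hp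
  have key : ∑ e ∈ Finset.Icc 1 γ, (1 : ℝ) / (p : ℝ) ^ e ≤
      2 / p - 2 * (1 / (p : ℝ) ^ γ * (1 / p)) := by
    induction γ with
    | zero =>
      have : (2 : ℝ) / p - 2 * (1 / (p : ℝ) ^ 0 * (1 / p)) = 0 := by
        rw [pow_zero]; ring
      rw [this]
      simp
    | succ n ih =>
      rw [Finset.sum_Icc_succ_top (by omega)]
      have h1 : (1 : ℝ) / p ≤ 1 / 2 := one_div_le_one_div_of_le (by norm_num) hp'
      have h2 : (1 : ℝ) / (p : ℝ) ^ (n + 1) = 1 / (p : ℝ) ^ n * (1 / p) := by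
        rw [pow_succ]; field_simp
      have h3 : (0 : ℝ) ≤ 1 / (p : ℝ) ^ n * (1 / p) := by positivity
      rw [h2]
      nlinarith
  have : (0 : ℝ) < 1 / (p : ℝ) ^ γ * (1 / p) := by positivity
  linarith

/-- Second moment estimate. -/
lemma second_moment {C : Finset (ℤ × ℕ)} (hC : HasDistinctModuli C) {Q : ℕ} (hQ : 0 < Q) {β : ℝ}
    {ρ : ℕ → ℝ} (hS : IsState C Q β ρ) {p : ℕ} (hp : 2 ≤ p) (γ : ℕ)
    (T : Finset (ℤ × ℕ)) (hT : T ⊆ C) (m e : ℤ × ℕ → ℕ)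
    (hme : ∀ c ∈ T, c.2 = m c * p ^ e c) (hm : ∀ c ∈ T, m c ∣ Q)
    (he : ∀ c ∈ T, e c ∈ Finset.Icc 1 γ) :
    ∑ x ∈ Finset.range Q, ρ x *
      (∑ c ∈ T, ind ((x : ℤ) ≡ c.1 [ZMOD (m c : ℤ)]) / ((p ^ e c : ℕ) : ℝ)) ^ 2 ≤
      4 / (p : ℝ) ^ 2 * divSum Q := by
  classical
  have hp0 : (0 : ℝ) < p := by exact_mod_cast (by omega : 0 < p)
  set w : ℕ × ℕ → ℕ × ℕ → ℝ := fun i j =>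
    1 / (p : ℝ) ^ i.2 * (1 / (p : ℝ) ^ j.2) * (tau (i.1.lcm j.1) / (i.1.lcm j.1 : ℕ)) with hw
  have hw0 : ∀ i j, 0 ≤ w i j := fun i j =>
    mul_nonneg (by positivity) (div_nonneg (tau_nonneg _) (by positivity))
  have h1 : ∑ x ∈ Finset.range Q, ρ x *
      (∑ c ∈ T, ind ((x : ℤ) ≡ c.1 [ZMOD (m c : ℤ)]) / ((p ^ e c : ℕ) : ℝ)) ^ 2 ≤
      ∑ c ∈ T, ∑ c' ∈ T, w (m c, e c) (m c', e c') := by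
    have : ∀ x, ρ x *
      (∑ c ∈ T, ind ((x : ℤ) ≡ c.1 [ZMOD (m c : ℤ)]) / ((p ^ e c : ℕ) : ℝ)) ^ 2 =
      ∑ c ∈ T, ∑ c' ∈ T, 1 / (p : ℝ) ^ e c * (1 / (p : ℝ) ^ e c') * (ρ x *
        (ind ((x : ℤ) ≡ c.1 [ZMOD (m c : ℤ)]) * ind ((x : ℤ) ≡ c'.1 [ZMOD (m c' : ℤ)]))) := by
      intro x
      rw [sq, Finset.sum_mul_sum, Finset.mul_sum]
      apply Finset.sum_congr rfl
      intro c _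
      rw [Finset.mul_sum]
      apply Finset.sum_congr rfl
      intro c' _
      push_cast
      ring
    rw [Finset.sum_congr rfl (fun x _ => this x), Finset.sum_comm]
    apply Finset.sum_le_sum
    intro c hc
    rw [Finset.sum_comm]
    apply Finset.sum_le_sum
    intro c' hc'
    rw [← Finset.mul_sum]
    exact mul_le_mul_of_nonneg_left (prog_lcm hS (hm c hc) (hm c' hc') _ _) (by positivity)
  refine h1.trans ?_
  have hinj : Set.InjOn (fun c => (m c, e c)) (T : Set (ℤ × ℕ)) := by
    intro c hc c' hc' heq
    by_contra hne
    apply hC c (hT hc) c' (hT hc') hne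
    simp only [Prod.mk.injEq] at heq
    rw [hme c hc, hme c' hc', heq.1, heq.2]
  set U := T.image (fun c => (m c, e c)) with hU
  have h2 : ∑ c ∈ T, ∑ c' ∈ T, w (m c, e c) (m c', e c') = ∑ i ∈ U, ∑ j ∈ U, w i j := by
    rw [hU, Finset.sum_image hinj]
    apply Finset.sum_congr rfl
    intro c _
    rw [Finset.sum_image hinj]
  have hUsub : U ⊆ Q.divisors ×ˢ Finset.Icc 1 γ := by
    intro i hi
    obtain ⟨c, hc, rfl⟩ := Finset.mem_image.1 hi
    exact Finset.mem_product.2 ⟨Nat.mem_divisors.2 ⟨hm c hc, hQ.ne'⟩, he c hc⟩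
  have h3 : ∑ i ∈ U, ∑ j ∈ U, w i j ≤
      ∑ i ∈ Q.divisors ×ˢ Finset.Icc 1 γ, ∑ j ∈ Q.divisors ×ˢ Finset.Icc 1 γ, w i j := by
    refine (Finset.sum_le_sum fun i _ => Finset.sum_le_sum_of_subset_of_nonneg hUsub
      (fun j _ _ => hw0 i j)).trans ?_
    exact Finset.sum_le_sum_of_subset_of_nonneg hUsub
      (fun i _ _ => Finset.sum_nonneg fun j _ => hw0 i j)
  rw [h2]
  refine h3.trans ?_
  have h4 : ∑ i ∈ Q.divisors ×ˢ Finset.Icc 1 γ, ∑ j ∈ Q.divisors ×ˢ Finset.Icc 1 γ, w i j =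
      (∑ e ∈ Finset.Icc 1 γ, (1 : ℝ) / (p : ℝ) ^ e) ^ 2 *
      ∑ m ∈ Q.divisors, ∑ n ∈ Q.divisors, tau (m.lcm n) / (m.lcm n : ℕ) := by
    simp only [hw]
    rw [Finset.sum_product, Finset.mul_sum]
    apply Finset.sum_congr rfl
    intro a _
    rw [sq, Finset.sum_mul, Finset.sum_mul]
    apply Finset.sum_congr rfl
    intro b _
    rw [Finset.sum_product, Finset.mul_sum]
    apply Finset.sum_congr rfl
    intro c _
    rw [Finset.mul_sum, Finset.sum_mul]
  rw [h4]
  have h5 := geom_bound hp γ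
  have h6 : 0 ≤ ∑ e ∈ Finset.Icc 1 γ, (1 : ℝ) / (p : ℝ) ^ e :=
    Finset.sum_nonneg fun _ _ => by positivity
  have h7 : (∑ e ∈ Finset.Icc 1 γ, (1 : ℝ) / (p : ℝ) ^ e) ^ 2 ≤ 4 / (p : ℝ) ^ 2 := by
    calc _ ≤ (2 / (p : ℝ)) ^ 2 := by gcongr
      _ = _ := by ring
  exact mul_le_mul h7 (lcm_sum_le Q) (Finset.sum_nonneg fun _ _ => Finset.sum_nonneg fun _ _ =>
    div_nonneg (tau_nonneg _) (by positivity)) (by positivity)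

lemma state_step {C : Finset (ℤ × ℕ)} (hC : HasDistinctModuli C) {Q : ℕ} (hQ : 0 < Q) {β : ℝ}
    {ρ : ℕ → ℝ} (hS : IsState C Q β ρ) {p : ℕ} (hp : p.Prime) (hpQ : p.Coprime Q) (γ : ℕ) :
    ∃ ρ' : ℕ → ℝ, IsState C (Q * p ^ γ) (β + 8 / (p : ℝ) ^ 2 * divSum Q) ρ' := by
  classical
  set q := p ^ γ with hq
  have hq0 : 0 < q := pow_pos hp.pos γ
  have hq0' : (0 : ℝ) < q := by exact_mod_cast hq0
  -- decomposition of divisors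
  have hdec : ∀ d, d ∣ Q * q → ∃ m e, d = m * p ^ e ∧ m ∣ Q ∧ e ≤ γ := by
    intro d hd
    obtain ⟨m, r, hm, hr, rfl⟩ := (Nat.dvd_mul).1 hd
    obtain ⟨e, he, rfl⟩ := (Nat.dvd_prime_pow hp).1 hr
    exact ⟨m, e, rfl, hm, he⟩
  set T := C.filter (fun c => c.2 ∣ Q * q ∧ ¬ c.2 ∣ Q) with hTdef
  set B : ℕ → Prop := fun y => ∃ c ∈ T, (y : ℤ) ≡ c.1 [ZMOD (c.2 : ℤ)] with hB
  choose g hg0 hg2 hg1 hgB using fun x : ℕ => exists_distortion q hq0 (fun t => B (x + t * Q))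
  have key : ∀ F : ℕ → ℝ, ∑ y ∈ Finset.range (Q * q), ρ (y % Q) * g (y % Q) (y / Q) / q * F y =
      ∑ x ∈ Finset.range Q, ρ x * ((∑ t ∈ Finset.range q, g x t * F (x + t * Q)) / q) := by
    intro F
    rw [sum_range_fibre]
    apply Finset.sum_congr rfl
    intro x hx
    have hxQ := Finset.mem_range.1 hx
    rw [Finset.sum_div, Finset.mul_sum]
    apply Finset.sum_congr rfl
    intro t _
    rw [Nat.add_mul_mod_self_right, Nat.mod_eq_of_lt hxQ, Nat.add_mul_div_right _ _ hQ,
      Nat.div_eq_of_lt hxQ, zero_add]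
    ring
  -- functions that only depend on the residue modulo Q
  have keyc : ∀ F : ℕ → ℝ, (∀ x t, F (x + t * Q) = F x) →
      ∑ y ∈ Finset.range (Q * q), ρ (y % Q) * g (y % Q) (y / Q) / q * F y =
      ∑ x ∈ Finset.range Q, ρ x * F x := by
    intro F hF
    rw [key]
    apply Finset.sum_congr rfl
    intro x _
    congr 1
    simp only [hF]
    rw [← Finset.sum_mul, hg1]
    field_simp
  refine ⟨fun y => ρ (y % Q) * g (y % Q) (y / Q) / q, ?_, ?_, ?_, ?_⟩
  · intro y
    exact div_nonneg (mul_nonneg (hS.nonneg _) (hg0 _ _)) hq0'.le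
  · have := keyc (fun _ => 1) (fun _ _ => rfl)
    simp only [mul_one] at this
    rw [this, hS.total]
  · intro d hd a
    obtain ⟨m, e, rfl, hm, he⟩ := hdec d hd
    have hm0 : 0 < m := Nat.pos_of_dvd_of_pos hm hQ
    have hm0' : (0 : ℝ) < m := by exact_mod_cast hm0
    rcases Nat.eq_zero_or_pos e with rfl | hepos
    · rw [pow_zero, mul_one]
      rw [keyc (fun y => ind ((y : ℤ) ≡ a [ZMOD (m : ℤ)]))
        (fun x t => ind_congr (modEq_shift hm x t a))]
      exact hS.prog m hm a
    · rw [key]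
      have hr0 : 0 < p ^ e := pow_pos hp.pos e
      have hr0' : (0 : ℝ) < ((p ^ e : ℕ) : ℝ) := by exact_mod_cast hr0
      have hqe : q = p ^ e * p ^ (γ - e) := by rw [hq, ← pow_add]; congr 1; omega
      have hle : ∀ x, (∑ t ∈ Finset.range q, g x t *
          ind (((x + t * Q : ℕ) : ℤ) ≡ a [ZMOD ((m * p ^ e : ℕ) : ℤ)])) / q ≤
          2 * (ind ((x : ℤ) ≡ a [ZMOD (m : ℤ)]) / ((p ^ e : ℕ) : ℝ)) := by
        intro x
        have h1 := count_prog Q (p ^ e) (p ^ (γ - e)) m hr0 (pow_pos hp.pos _)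
          (hpQ.pow_left e) hm x a
        rw [← hqe] at h1
        calc _ ≤ (∑ t ∈ Finset.range q, 2 *
          ind (((x + t * Q : ℕ) : ℤ) ≡ a [ZMOD ((m * p ^ e : ℕ) : ℤ)])) / q := by
              apply div_le_div_of_nonneg_right _ hq0'.le
              exact Finset.sum_le_sum fun t _ =>
                mul_le_mul_of_nonneg_right (hg2 x t) (ind_nonneg _)
          _ = 2 * ((∑ t ∈ Finset.range q,
          ind (((x + t * Q : ℕ) : ℤ) ≡ a [ZMOD ((m * p ^ e : ℕ) : ℤ)])) / q) := by
              rw [← Finset.mul_sum]; ring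
          _ ≤ _ := by linarith
      calc _ ≤ ∑ x ∈ Finset.range Q, ρ x *
            (2 * (ind ((x : ℤ) ≡ a [ZMOD (m : ℤ)]) / ((p ^ e : ℕ) : ℝ))) :=
            Finset.sum_le_sum fun x _ => mul_le_mul_of_nonneg_left (hle x) (hS.nonneg x)
        _ = 2 / ((p ^ e : ℕ) : ℝ) *
            ∑ x ∈ Finset.range Q, ρ x * ind ((x : ℤ) ≡ a [ZMOD (m : ℤ)]) := by
            rw [Finset.mul_sum]
            apply Finset.sum_congr rfl
            intro x _
            ring
        _ ≤ 2 / ((p ^ e : ℕ) : ℝ) * (tau m / m) :=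
            mul_le_mul_of_nonneg_left (hS.prog m hm a) (by positivity)
        _ ≤ tau (m * p ^ e) / ((m * p ^ e : ℕ) : ℝ) := by
            have hcop : m.Coprime (p ^ e) := ((hpQ.coprime_dvd_right hm).pow_left e).symm
            rw [tau_mul hcop, tau_prime_pow hp, Nat.cast_mul]
            have h1 : (1 : ℝ) ≤ e := by exact_mod_cast hepos
            have h2 : 2 / ((p ^ e : ℕ) : ℝ) * (tau m / m) =
              tau m * 2 / (m * ((p ^ e : ℕ) : ℝ)) := by field_simp
            rw [h2]
            apply div_le_div_of_nonneg_right _ (by positivity)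
            exact mul_le_mul_of_nonneg_left (by linarith) (tau_nonneg m)
  · set F1 : ℕ → ℝ := fun y => ind (∃ c ∈ C, c.2 ∣ Q ∧ (y : ℤ) ≡ c.1 [ZMOD (c.2 : ℤ)]) with hF1
    have hsplit : ∀ y : ℕ, ind (∃ c ∈ C, c.2 ∣ Q * q ∧ (y : ℤ) ≡ c.1 [ZMOD (c.2 : ℤ)]) ≤
        F1 y + ind (B y) := by
      intro y
      refine le_trans (ind_mono ?_) (ind_or_le _ _)
      rintro ⟨c, hc, hd, hy⟩
      by_cases hdQ : c.2 ∣ Q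
      · exact Or.inl ⟨c, hc, hdQ, hy⟩
      · exact Or.inr ⟨c, Finset.mem_filter.2 ⟨hc, hd, hdQ⟩, hy⟩
    have hF1c : ∀ x t, F1 (x + t * Q) = F1 x := by
      intro x t
      apply ind_congr
      constructor
      · rintro ⟨c, hc, hd, hy⟩
        exact ⟨c, hc, hd, (modEq_shift hd x t _).1 hy⟩
      · rintro ⟨c, hc, hd, hy⟩
        exact ⟨c, hc, hd, (modEq_shift hd x t _).2 hy⟩
    have hdecT : ∀ c : ℤ × ℕ, ∃ m e, c ∈ T → (c.2 = m * p ^ e ∧ m ∣ Q ∧ e ∈ Finset.Icc 1 γ) := by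
      intro c
      by_cases hc : c ∈ T
      · have hc' := (Finset.mem_filter.1 hc).2
        obtain ⟨m, e, h1, h2, h3⟩ := hdec c.2 hc'.1
        refine ⟨m, e, fun _ => ⟨h1, h2, Finset.mem_Icc.2 ⟨?_, h3⟩⟩⟩
        by_contra h
        have : e = 0 := by omega
        subst this
        rw [pow_zero, mul_one] at h1
        exact hc'.2 (h1 ▸ h2)
      · exact ⟨0, 0, fun h => absurd h hc⟩
    choose m e hme using hdecT
    have hα : ∀ x, (∑ t ∈ Finset.range q, ind (B (x + t * Q))) / q ≤
        ∑ c ∈ T, ind ((x : ℤ) ≡ c.1 [ZMOD (m c : ℤ)]) / ((p ^ e c : ℕ) : ℝ) := by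
      intro x
      calc _ ≤ (∑ t ∈ Finset.range q, ∑ c ∈ T,
            ind (((x + t * Q : ℕ) : ℤ) ≡ c.1 [ZMOD (c.2 : ℤ)])) / q := by
            apply div_le_div_of_nonneg_right _ hq0'.le
            exact Finset.sum_le_sum fun t _ => ind_exists_le T _
        _ = ∑ c ∈ T, (∑ t ∈ Finset.range q,
            ind (((x + t * Q : ℕ) : ℤ) ≡ c.1 [ZMOD (c.2 : ℤ)])) / q := by
            rw [Finset.sum_comm, Finset.sum_div]
        _ ≤ _ := by
            apply Finset.sum_le_sum
            intro c hc
            obtain ⟨h1, h2, h3⟩ := hme c hc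
            have h4 := count_prog Q (p ^ e c) (p ^ (γ - e c)) (m c) (pow_pos hp.pos _)
              (pow_pos hp.pos _) (hpQ.pow_left _) h2 x c.1
            have hqe : p ^ e c * p ^ (γ - e c) = q := by
              rw [hq, ← pow_add]; congr 1
              have := (Finset.mem_Icc.1 h3).2
              omega
            rw [hqe, ← h1] at h4
            exact h4
    calc _ ≤ ∑ y ∈ Finset.range (Q * q), (ρ (y % Q) * g (y % Q) (y / Q) / q * F1 y +
          ρ (y % Q) * g (y % Q) (y / Q) / q * ind (B y)) := by
          apply Finset.sum_le_sum
          intro y _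
          rw [← mul_add]
          exact mul_le_mul_of_nonneg_left (hsplit y)
            (div_nonneg (mul_nonneg (hS.nonneg _) (hg0 _ _)) hq0'.le)
      _ = ∑ x ∈ Finset.range Q, ρ x * F1 x +
          ∑ x ∈ Finset.range Q, ρ x * ((∑ t ∈ Finset.range q, g x t * ind (B (x + t * Q))) / q) := by
          rw [Finset.sum_add_distrib, keyc F1 hF1c, key]
      _ ≤ β + 2 * ∑ x ∈ Finset.range Q, ρ x *
          (∑ c ∈ T, ind ((x : ℤ) ≡ c.1 [ZMOD (m c : ℤ)]) / ((p ^ e c : ℕ) : ℝ)) ^ 2 := by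
          apply add_le_add hS.bad
          rw [Finset.mul_sum]
          apply Finset.sum_le_sum
          intro x _
          rw [mul_left_comm]
          apply mul_le_mul_of_nonneg_left _ (hS.nonneg x)
          have h0 : 0 ≤ (∑ t ∈ Finset.range q, ind (B (x + t * Q))) / q :=
            div_nonneg (Finset.sum_nonneg fun _ _ => ind_nonneg _) hq0'.le
          have h1 := pow_le_pow_left₀ h0 (hα x) 2
          rw [div_le_iff₀ hq0']
          refine (hgB x).trans ?_
          nlinarith
      _ ≤ β + 2 * (4 / (p : ℝ) ^ 2 * divSum Q) := by
          have := second_moment hC hQ hS hp.two_le γ T (Finset.filter_subset _ _) m e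
            (fun c hc => (hme c hc).1) (fun c hc => (hme c hc).2.1) (fun c hc => (hme c hc).2.2)
          linarith
      _ = _ := by ring

/-! ### Analytic estimates -/

/-- The multiplicative weight `τ(l)^3 / l`. -/
noncomputable def wt (l : ℕ) : ℝ := tau l ^ 3 / l

lemma wt_nonneg (l : ℕ) : 0 ≤ wt l := div_nonneg (pow_nonneg (tau_nonneg l) 3) (by positivity)

lemma wt_one : wt 1 = 1 := by simp [wt, tau]

lemma wt_mul {m n : ℕ} (h : m.Coprime n) : wt (m * n) = wt m * wt n := by
  unfold wt; rw [tau_mul h]; push_cast; ring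

lemma wt_prime_pow {p : ℕ} (hp : p.Prime) (e : ℕ) : wt (p ^ e) = ((e : ℝ) + 1) ^ 3 / (p : ℝ) ^ e := by
  unfold wt; rw [tau_prime_pow hp]; push_cast; rfl

lemma summable_aux (j : ℕ) : Summable (fun n : ℕ => ((n : ℝ) + j) ^ 3 / (2 : ℝ) ^ n) := by
  have h1 : Summable (fun n : ℕ => (n : ℝ) ^ 3 * (1 / 2 : ℝ) ^ n) :=
    summable_pow_mul_geometric_of_norm_lt_one 3 (by norm_num)
  have h2 := ((summable_nat_add_iff j).2 h1).mul_left ((2 : ℝ) ^ j)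
  refine h2.congr fun n => ?_
  push_cast
  rw [pow_add]
  simp only [one_div, inv_pow]
  field_simp

lemma wt_summable {p : ℕ} (hp : p.Prime) : Summable (fun n : ℕ => wt (p ^ n)) := by
  refine Summable.of_nonneg_of_le (fun n => wt_nonneg _) (fun n => ?_) (summable_aux 1)
  rw [wt_prime_pow hp]
  have : (2 : ℝ) ≤ p := by exact_mod_cast hp.two_le
  push_cast
  gcongr

lemma wt_tsum_le : ∃ A : ℝ, 0 ≤ A ∧ ∀ p : ℕ, p.Prime → ∑' n : ℕ, wt (p ^ n) ≤ 1 + A / p := by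
  refine ⟨∑' n : ℕ, ((n : ℝ) + (2 : ℕ)) ^ 3 / (2 : ℝ) ^ n, tsum_nonneg fun n => by positivity, ?_⟩
  intro p hp
  have h2 : (2 : ℝ) ≤ p := by exact_mod_cast hp.two_le
  rw [(wt_summable hp).tsum_eq_zero_add, pow_zero, wt_one]
  apply add_le_add le_rfl
  rw [← tsum_div_const]
  apply Summable.tsum_le_tsum _ ((summable_nat_add_iff 1).2 (wt_summable hp))
    ((summable_aux 2).div_const _)
  intro n
  rw [wt_prime_pow hp, pow_succ (p : ℝ) n, div_div]
  push_cast
  have : (n : ℝ) + 1 + 1 = n + 2 := by ring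
  rw [this]
  gcongr

lemma wt_smooth (s : ℕ) : Summable (fun m : s.smoothNumbers ↦ wt m) ∧
      HasSum (fun m : s.smoothNumbers ↦ wt m) (∏ p ∈ s.primesBelow, ∑' n : ℕ, wt (p ^ n)) := by
  have h := EulerProduct.summable_and_hasSum_smoothNumbers_prod_primesBelow_tsum (f := wt) wt_one
    (fun {m n} h => wt_mul h) (fun {p} hp => (wt_summable hp).norm) s
  exact ⟨h.1.of_norm, h.2⟩

lemma divSum_le {s Q : ℕ} (hQ : Q ∈ s.smoothNumbers) :
    divSum Q ≤ ∏ p ∈ s.primesBelow, ∑' n : ℕ, wt (p ^ n) := by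
  classical
  have hmem : ∀ l ∈ Q.divisors, l ∈ s.smoothNumbers := fun l hl =>
    Nat.mem_smoothNumbers_of_dvd hQ (Nat.dvd_of_mem_divisors hl)
  have h1 : divSum Q = ∑ l ∈ Q.divisors.subtype (· ∈ s.smoothNumbers), wt l :=
    (Finset.sum_subtype_of_mem wt hmem).symm
  rw [h1]
  exact sum_le_hasSum _ (fun l _ => wt_nonneg _) (wt_smooth s).2

lemma pow_dvd_factorial_mul {p : ℕ} (hp : 0 < p) (k : ℕ) : p ^ k ∣ (k * p).factorial := by
  induction k with
  | zero => simp
  | succ k ih =>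
    rw [Nat.succ_mul, pow_succ]
    exact (mul_dvd_mul ih (Nat.dvd_factorial hp le_rfl)).trans
      (Nat.factorial_mul_factorial_dvd_factorial_add _ _)

lemma sum_log_div_le {n : ℕ} (hn : 0 < n) :
    ∑ p ∈ (n + 1).primesBelow, Real.log p / p ≤ 2 * Real.log n := by
  have hn' : (0 : ℝ) < n := by exact_mod_cast hn
  have hdvd : ∏ p ∈ (n + 1).primesBelow, p ^ (n / p) ∣ n.factorial := by
    apply Finset.prod_dvd_of_isRelPrime
    · intro a ha b hb hab
      have ha' := Nat.prime_of_mem_primesBelow ha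
      have hb' := Nat.prime_of_mem_primesBelow hb
      exact Nat.coprime_iff_isRelPrime.1 (((Nat.coprime_primes ha' hb').2 hab).pow _ _)
    · intro p hp
      exact (pow_dvd_factorial_mul (Nat.prime_of_mem_primesBelow hp).pos _).trans
        (Nat.factorial_dvd_factorial (Nat.div_mul_le_self n p))
  have hle : ((∏ p ∈ (n + 1).primesBelow, p ^ (n / p) : ℕ) : ℝ) ≤ (n : ℝ) ^ n := by
    exact_mod_cast (Nat.le_of_dvd (Nat.factorial_pos n) hdvd).trans (Nat.factorial_le_pow n)
  have hpos : ∀ p ∈ (n + 1).primesBelow, (0 : ℝ) < p := fun p hp => by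
    exact_mod_cast (Nat.prime_of_mem_primesBelow hp).pos
  have hlog : ∑ p ∈ (n + 1).primesBelow, ((n / p : ℕ) : ℝ) * Real.log p ≤ n * Real.log n := by
    have h1 := Real.log_le_log (by
      push_cast
      exact Finset.prod_pos fun p hp => pow_pos (hpos p hp) _) hle
    rw [Real.log_pow] at h1
    push_cast at h1
    rw [Real.log_prod (fun p hp => (pow_pos (hpos p hp) _).ne')] at h1
    refine le_trans (le_of_eq ?_) h1
    apply Finset.sum_congr rfl
    intro p _
    rw [Real.log_pow]
  have h2 : ∑ p ∈ (n + 1).primesBelow, (n : ℝ) / 2 * (Real.log p / p) ≤ n * Real.log n := by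
    refine le_trans (Finset.sum_le_sum fun p hp => ?_) hlog
    have hp0 := hpos p hp
    have hpp := Nat.prime_of_mem_primesBelow hp
    have hpn : p ≤ n := Nat.lt_succ_iff.1 (Nat.lt_of_mem_primesBelow hp)
    have hlp : 0 ≤ Real.log p := Real.log_nonneg (by exact_mod_cast hpp.one_lt.le)
    have h3 : n ≤ 2 * (p * (n / p)) := by
      have h4 := Nat.div_add_mod n p
      have h5 := Nat.mod_lt n hpp.pos
      have h6 : 1 ≤ n / p := Nat.div_pos hpn hpp.pos
      nlinarith
    have h4 : (n : ℝ) ≤ 2 * (p * ((n / p : ℕ) : ℝ)) := by exact_mod_cast h3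
    have h5 : (n : ℝ) / 2 * (Real.log p / p) = (n / (2 * p)) * Real.log p := by field_simp
    rw [h5]
    apply mul_le_mul_of_nonneg_right _ hlp
    rw [div_le_iff₀ (by positivity)]
    linarith
  rw [← Finset.mul_sum] at h2
  have h3 : (n : ℝ) * (∑ p ∈ (n + 1).primesBelow, Real.log p / p) ≤ n * (2 * Real.log n) := by
    linarith
  exact le_of_mul_le_mul_left h3 hn'

lemma sum_inv_le {M : ℕ} (hM : 2 ≤ M) {s : ℕ} (hs : 1 ≤ s) :
    ∑ p ∈ s.primesBelow, (1 : ℝ) / p ≤ M + 2 * Real.log s / Real.log M := by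
  have hlM : 0 < Real.log M := Real.log_pos (by exact_mod_cast hM)
  have hsub : s.primesBelow ⊆ (s + 1).primesBelow := by
    intro p hp
    rw [Nat.mem_primesBelow] at hp ⊢
    exact ⟨by omega, hp.2⟩
  have hpt : ∀ p ∈ s.primesBelow, (1 : ℝ) / p ≤
      ind (p < M) + Real.log p / p / Real.log M := by
    intro p hp
    have hpp := Nat.prime_of_mem_primesBelow hp
    have hp1 : (1 : ℝ) ≤ p := by exact_mod_cast hpp.one_lt.le
    have hlp : 0 ≤ Real.log p := Real.log_nonneg hp1
    by_cases h : p < M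
    · rw [ind_true h]
      have h1 : (1 : ℝ) / p ≤ 1 := by rw [div_le_one (by linarith)]; exact hp1
      have : 0 ≤ Real.log p / p / Real.log M := by positivity
      linarith
    · rw [ind_false h, zero_add, le_div_iff₀ hlM, div_mul_eq_mul_div, one_mul]
      apply div_le_div_of_nonneg_right _ (by linarith)
      apply Real.log_le_log (by exact_mod_cast (by omega : 0 < M))
      exact_mod_cast not_lt.1 h
  refine (Finset.sum_le_sum hpt).trans ?_
  rw [Finset.sum_add_distrib]
  apply add_le_add
  · classical
    have h1 : ∑ p ∈ s.primesBelow, ind (p < M) = ((s.primesBelow.filter (· < M)).card : ℝ) := by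
      rw [Finset.card_filter]
      push_cast
      apply Finset.sum_congr rfl
      intro t _
      unfold ind
      split_ifs <;> rfl
    rw [h1]
    have h2 : (s.primesBelow.filter (· < M)).card ≤ (Finset.range M).card := by
      apply Finset.card_le_card
      intro p hp
      exact Finset.mem_range.2 (Finset.mem_filter.1 hp).2
    rw [Finset.card_range] at h2
    exact_mod_cast h2
  · rw [← Finset.sum_div]
    apply div_le_div_of_nonneg_right _ hlM.le
    refine le_trans ?_ (sum_log_div_le (by omega))
    apply Finset.sum_le_sum_of_subset_of_nonneg hsub
    intro p hp _
    have hpp := Nat.prime_of_mem_primesBelow hp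
    exact div_nonneg (Real.log_nonneg (by exact_mod_cast hpp.one_lt.le)) (by positivity)

lemma divSum_bound : ∃ D : ℝ, 0 ≤ D ∧ ∀ s : ℕ, 1 ≤ s → ∀ Q ∈ s.smoothNumbers,
    8 / (s : ℝ) ^ 2 * divSum Q ≤ D * (1 / (s : ℝ) ^ (3 / 2 : ℝ)) := by
  obtain ⟨A, hA, hAp⟩ := wt_tsum_le
  set M : ℕ := ⌈Real.exp (4 * A)⌉₊ + 2 with hM
  have hM2 : 2 ≤ M := by omega
  have hlM : 4 * A ≤ Real.log M := by
    rw [Real.le_log_iff_exp_le (by positivity)]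
    refine (Nat.le_ceil _).trans ?_
    rw [hM]; push_cast; linarith
  have hlM0 : 0 < Real.log M := Real.log_pos (by exact_mod_cast hM2)
  refine ⟨8 * Real.exp (A * M), by positivity, ?_⟩
  intro s hs Q hQ
  have hs' : (0 : ℝ) < s := by exact_mod_cast hs
  have hls : 0 ≤ Real.log s := Real.log_nonneg (by exact_mod_cast hs)
  have h1 : divSum Q ≤ Real.exp (A * M) * (s : ℝ) ^ (1 / 2 : ℝ) := by
    calc divSum Q ≤ ∏ p ∈ s.primesBelow, ∑' n : ℕ, wt (p ^ n) := divSum_le hQ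
      _ ≤ ∏ p ∈ s.primesBelow, Real.exp (A * (1 / p)) := by
          apply Finset.prod_le_prod
          · intro p _; exact tsum_nonneg fun n => wt_nonneg _
          · intro p hp
            refine (hAp p (Nat.prime_of_mem_primesBelow hp)).trans ?_
            have := Real.add_one_le_exp (A * (1 / (p : ℝ)))
            rw [mul_one_div] at this ⊢
            linarith
      _ = Real.exp (A * ∑ p ∈ s.primesBelow, (1 : ℝ) / p) := by
          rw [← Real.exp_sum, Finset.mul_sum]
      _ ≤ Real.exp (A * M + Real.log s * (1 / 2)) := by
          apply Real.exp_le_exp.2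
          have h2 := mul_le_mul_of_nonneg_left (sum_inv_le hM2 hs) hA
          have h3 : A * (2 * Real.log s / Real.log M) ≤ Real.log s * (1 / 2) := by
            rw [mul_div_assoc', div_le_iff₀ hlM0]
            nlinarith
          linarith
      _ = _ := by rw [Real.exp_add, Real.rpow_def_of_pos hs']
  have h2 : (s : ℝ) ^ 2 = (s : ℝ) ^ (1 / 2 : ℝ) * (s : ℝ) ^ (3 / 2 : ℝ) := by
    rw [← Real.rpow_add hs', ← Real.rpow_natCast]
    norm_num
  have h3 : (0 : ℝ) < (s : ℝ) ^ (1 / 2 : ℝ) := by positivity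
  have h4 : (0 : ℝ) < (s : ℝ) ^ (3 / 2 : ℝ) := by positivity
  calc 8 / (s : ℝ) ^ 2 * divSum Q ≤
      8 / (s : ℝ) ^ 2 * (Real.exp (A * M) * (s : ℝ) ^ (1 / 2 : ℝ)) :=
        mul_le_mul_of_nonneg_left h1 (by positivity)
    _ = _ := by rw [h2]; field_simp

lemma exists_tail {f : ℕ → ℝ} (hf : Summable f) :
    ∃ k : ℕ, ∀ t : Finset ℕ, (∀ i ∈ t, k < i) → ∑ i ∈ t, f i < 1 / 2 := by
  obtain ⟨u, hu⟩ := summable_iff_vanishing_norm.1 hf (1 / 2) (by norm_num)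
  refine ⟨u.sup id, fun t ht => ?_⟩
  refine (le_abs_self _).trans_lt (hu t ?_)
  rw [Finset.disjoint_left]
  intro i hi hiu
  have := Finset.le_sup (f := id) hiu
  have := ht i hi
  simp only [id] at *
  omega

/-! ### The main argument -/

/-- The `s`-smooth part of `L`. -/
def smoothPart (L s : ℕ) : ℕ := ∏ p ∈ s.primesBelow, p ^ L.factorization p

lemma smoothPart_succ_prime {L s : ℕ} (hs : s.Prime) :
    smoothPart L (s + 1) = smoothPart L s * s ^ L.factorization s := by
  unfold smoothPart
  rw [Nat.primesBelow_succ, if_pos hs, Finset.prod_insert (Nat.notMem_primesBelow s), mul_comm]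

lemma smoothPart_succ_not_prime {L s : ℕ} (hs : ¬ s.Prime) :
    smoothPart L (s + 1) = smoothPart L s := by
  unfold smoothPart
  rw [Nat.primesBelow_succ, if_neg hs]

lemma smoothPart_mem (L s : ℕ) : smoothPart L s ∈ s.smoothNumbers := by
  induction s with
  | zero => simp [smoothPart, Nat.smoothNumbers_zero, Nat.primesBelow]
  | succ s ih =>
    by_cases hs : s.Prime
    · rw [smoothPart_succ_prime hs, mul_comm]
      exact Nat.pow_mul_mem_smoothNumbers hs.ne_zero _ ih
    · rw [smoothPart_succ_not_prime hs]
      exact Nat.smoothNumbers_mono (Nat.le_succ s) ih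

lemma smoothPart_eq {L s : ℕ} (hL : L ≠ 0) (hs : L < s) : smoothPart L s = L := by
  conv_rhs => rw [← Nat.prod_factorization_pow_eq_self hL]
  unfold smoothPart
  rw [Finsupp.prod, Nat.support_factorization]
  symm
  apply Finset.prod_subset
  · intro p hp
    rw [Nat.mem_primesBelow]
    exact ⟨(Nat.le_of_mem_primeFactors hp).trans_lt hs, Nat.prime_of_mem_primeFactors hp⟩
  · intro p _ hp
    rw [← Nat.support_factorization, Finsupp.notMem_support_iff] at hp
    rw [hp, pow_zero]

lemma one_le_tau {m : ℕ} (hm : m ≠ 0) : 1 ≤ tau m := by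
  unfold tau
  exact_mod_cast Finset.card_pos.2 ⟨1, by simp [hm]⟩

lemma initial_prog {Q m : ℕ} (hQ : 0 < Q) (hm : m ∣ Q) (a : ℤ) :
    ∑ x ∈ Finset.range Q, (1 : ℝ) / Q * ind ((x : ℤ) ≡ a [ZMOD (m : ℤ)]) ≤ 1 / m := by
  obtain ⟨k, rfl⟩ := hm
  have hm0 : 0 < m := Nat.pos_of_mul_pos_right hQ
  have hk0 : 0 < k := Nat.pos_of_mul_pos_left hQ
  have h := sum_ind_le 1 m k (Nat.coprime_one_right m) 0 a
  simp only [zero_add, mul_one] at h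
  rw [← Finset.mul_sum]
  have hm0' : (0 : ℝ) < m := by exact_mod_cast hm0
  have hk0' : (0 : ℝ) < k := by exact_mod_cast hk0
  calc _ ≤ (1 : ℝ) / (m * k : ℕ) * k := mul_le_mul_of_nonneg_left h (by positivity)
    _ = _ := by push_cast; field_simp

lemma initial_state {C : Finset (ℤ × ℕ)} {Q : ℕ} (hQ : 0 < Q) :
    IsState C Q (∑ c ∈ C with c.2 ∣ Q, (1 : ℝ) / c.2) (fun _ => 1 / Q) := by
  have hQ' : (0 : ℝ) < Q := by exact_mod_cast hQ
  refine ⟨fun _ => by positivity, ?_, ?_, ?_⟩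
  · simp; field_simp
  · intro m hm a
    refine (initial_prog hQ hm a).trans ?_
    exact div_le_div_of_nonneg_right (one_le_tau (Nat.pos_of_dvd_of_pos hm hQ).ne')
      (by positivity)
  · calc _ ≤ ∑ x ∈ Finset.range Q, ∑ c ∈ C with c.2 ∣ Q,
          (1 : ℝ) / Q * ind ((x : ℤ) ≡ c.1 [ZMOD (c.2 : ℤ)]) := by
          apply Finset.sum_le_sum
          intro x _
          rw [← Finset.mul_sum]
          apply mul_le_mul_of_nonneg_left _ (by positivity)
          refine le_trans (ind_mono ?_) (ind_exists_le _ _)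
          rintro ⟨c, hc, hd, hx⟩
          exact ⟨c, Finset.mem_filter.2 ⟨hc, hd⟩, hx⟩
      _ ≤ _ := by
          rw [Finset.sum_comm]
          apply Finset.sum_le_sum
          intro c hc
          exact initial_prog hQ (Finset.mem_filter.1 hc).2 c.1

/-- Hough's theorem: the least modulus of a distinct covering system is bounded. -/
theorem min_modulus_bounded : ∃ N₀ : ℕ, ¬ ∃ C : Finset (ℤ × ℕ), IsCoveringSystem C ∧
    HasDistinctModuli C ∧ ∀ c ∈ C, N₀ < c.2 := by
  classical
  obtain ⟨D, hD, hDb⟩ := divSum_bound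
  have hsum : Summable (fun s : ℕ => D * (1 / (s : ℝ) ^ (3 / 2 : ℝ))) :=
    (Real.summable_one_div_nat_rpow.2 (by norm_num)).mul_left D
  obtain ⟨k', hk'⟩ := exists_tail hsum
  set k := k' + 1 with hk
  have hsm : Summable (Set.indicator (k.smoothNumbers) wt) :=
    summable_subtype_iff_indicator.1 (wt_smooth k).1
  obtain ⟨N₀, hN₀⟩ := exists_tail hsm
  refine ⟨N₀, ?_⟩
  rintro ⟨C, ⟨hpos, hcov⟩, hdist, hbig⟩
  set L := ∏ c ∈ C, c.2 with hL
  have hL0 : L ≠ 0 := Finset.prod_ne_zero_iff.2 fun c hc => (hpos c hc).ne'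
  have hsp : ∀ s, 0 < smoothPart L s := fun s =>
    Nat.pos_of_ne_zero (Nat.ne_zero_of_mem_smoothNumbers (smoothPart_mem L s))
  set β₀ : ℝ := ∑ c ∈ C with c.2 ∣ smoothPart L k, (1 : ℝ) / c.2 with hβ₀
  have hβ : β₀ < 1 / 2 := by
    set T := C.filter (fun c => c.2 ∣ smoothPart L k) with hT
    have hinj : Set.InjOn (fun c : ℤ × ℕ => c.2) (T : Set (ℤ × ℕ)) := by
      intro c hc c' hc' heq
      by_contra hne
      exact hdist c (Finset.mem_filter.1 hc).1 c' (Finset.mem_filter.1 hc').1 hne heq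
    have h1 := hN₀ (T.image (fun c => c.2)) (by
      intro i hi
      obtain ⟨c, hc, rfl⟩ := Finset.mem_image.1 hi
      exact hbig c (Finset.mem_filter.1 hc).1)
    rw [Finset.sum_image hinj] at h1
    refine lt_of_le_of_lt (Finset.sum_le_sum fun c hc => ?_) h1
    have hc' := Finset.mem_filter.1 hc
    have hcm : c.2 ∈ k.smoothNumbers := Nat.mem_smoothNumbers_of_dvd (smoothPart_mem L k) hc'.2
    rw [Set.indicator_of_mem hcm]
    unfold wt
    apply div_le_div_of_nonneg_right _ (by positivity)
    exact one_le_pow₀ (one_le_tau (hpos c hc'.1).ne')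
  have hind : ∀ n : ℕ, ∃ ρ, IsState C (smoothPart L (k + n))
      (β₀ + ∑ s ∈ Finset.Ico k (k + n), D * (1 / (s : ℝ) ^ (3 / 2 : ℝ))) ρ := by
    intro n
    induction n with
    | zero =>
      refine ⟨fun _ => 1 / (smoothPart L k : ℕ), ?_⟩
      simp only [add_zero, Finset.Ico_self, Finset.sum_empty]
      exact initial_state (hsp k)
    | succ n ih =>
      obtain ⟨ρ, hρ⟩ := ih
      have hkn : k + (n + 1) = (k + n) + 1 := by ring
      rw [hkn, Finset.sum_Ico_succ_top (by omega), ← add_assoc]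
      by_cases hs : (k + n).Prime
      · rw [smoothPart_succ_prime hs]
        obtain ⟨ρ', hρ'⟩ := state_step hdist (hsp _) hρ hs
          (hs.smoothNumbers_coprime (smoothPart_mem L _)) (L.factorization (k + n))
        refine ⟨ρ', hρ'.nonneg, hρ'.total, hρ'.prog, hρ'.bad.trans ?_⟩
        exact add_le_add le_rfl (hDb (k + n) (by omega) _ (smoothPart_mem L _))
      · rw [smoothPart_succ_not_prime hs]
        refine ⟨ρ, hρ.nonneg, hρ.total, hρ.prog, hρ.bad.trans ?_⟩
        have : 0 ≤ D * (1 / ((k + n : ℕ) : ℝ) ^ (3 / 2 : ℝ)) := by positivity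
        linarith
  obtain ⟨ρ, hρ⟩ := hind (L + 1)
  rw [smoothPart_eq hL0 (by omega)] at hρ
  have h1 := hk' (Finset.Ico k (k + (L + 1))) (by
    intro i hi
    have := (Finset.mem_Ico.1 hi).1
    omega)
  have h2 := hρ.bad
  have h3 : ∑ x ∈ Finset.range L,
      ρ x * ind (∃ c ∈ C, c.2 ∣ L ∧ (x : ℤ) ≡ c.1 [ZMOD (c.2 : ℤ)]) = 1 := by
    rw [← hρ.total]
    apply Finset.sum_congr rfl
    intro x _
    obtain ⟨c, hc, hx⟩ := hcov x
    rw [ind_true ⟨c, hc, Finset.dvd_prod_of_mem (fun c : ℤ × ℕ => c.2) hc, hx⟩, mul_one]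
  linarith

/-- Filaseta–Ford–Konyagin–Pomerance–Yu: for any `K > 1` and all sufficiently large
`N`, there is no covering system with distinct moduli all lying in `(N, K N]`. -/
theorem no_covering_in_interval (K : ℝ) (hK : 1 < K) :
    ∃ N₀ : ℕ, ∀ N : ℕ, N₀ ≤ N →
      ¬ ∃ C : Finset (ℤ × ℕ), IsCoveringSystem C ∧ HasDistinctModuli C ∧
        ∀ c ∈ C, (N : ℝ) < c.2 ∧ (c.2 : ℝ) ≤ K * N := by
  obtain ⟨N₀, hN₀⟩ := min_modulus_bounded
  refine ⟨N₀, fun N hN ⟨C, hC, hd, hc⟩ => hN₀ ⟨C, hC, hd, fun c hcC => ?_⟩⟩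
  have h : N < c.2 := by exact_mod_cast (hc c hcC).1
  omega
end
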